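/- For every s ∈ ℝ there is a constant C_s such that for all u ∈ H^{s+3/8}(ℝ), ‖e^{−itΛ}u‖_{L^4_t(ℝ; C_*^s(ℝ))} ≤ C_s ‖u‖_{H^{s+3/8}}, where e^{−itΛ} is the Fourier multiplier operator with symbol e^{−it|ξ|^{1/2}}. -/

import Mathlib

open MeasureTheory Complex Filter
open scoped ENNReal FourierTransform Real

noncomputable section

/-- Complexification of a real-valued function. -/
def cplx (f : ℝ → ℝ) : ℝ → ℂ := fun x => (f x : ℂ)

/-- `L²`-based Sobolev norm `H^s` on `ℝ`, as an extended nonnegative real. -/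
def HNorm (s : ℝ) (u : ℝ → ℂ) : ℝ≥0∞ :=
  (∫⁻ ξ : ℝ, ENNReal.ofReal ((1 + ξ ^ 2) ^ s) * (‖𝓕 u ξ‖₊ : ℝ≥0∞) ^ 2) ^ (1/2 : ℝ)

/-- A Littlewood–Paley family: a smooth bump supported in the annulus `1/2 ≤ |ξ| ≤ 2`
whose dyadic dilates form a partition of unity away from the origin. -/
structure LPFamily where
  χ : ℝ → ℝ
  smooth : ContDiff ℝ (⊤ : ℕ∞) χ
  supp : ∀ ξ : ℝ, χ ξ ≠ 0 → |ξ| ∈ Set.Icc (1/2 : ℝ) 2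
  hsum : ∀ ξ : ℝ, ξ ≠ 0 → HasSum (fun k : ℤ => χ (ξ / 2 ^ k)) 1

/-- Littlewood–Paley projection `P_k` onto frequencies `|ξ| ≈ 2^k`. -/
def LP (χ : ℝ → ℝ) (k : ℤ) (u : ℝ → ℂ) : ℝ → ℂ :=
  𝓕⁻ (fun ξ => (χ (ξ / 2 ^ k) : ℂ) * 𝓕 u ξ)

/-- Low-frequency Littlewood–Paley projection `P_{≤0}`. -/
def LPlow (χ : ℝ → ℝ) (u : ℝ → ℂ) : ℝ → ℂ :=
  𝓕⁻ (fun ξ => ((1 - ∑' k : ℕ, χ (ξ / 2 ^ (k + 1)) : ℝ) : ℂ) * 𝓕 u ξ)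

/-- Sup-norm, as an extended nonnegative real. -/
def LooNorm (f : ℝ → ℂ) : ℝ≥0∞ := ⨆ x : ℝ, (‖f x‖₊ : ℝ≥0∞)

/-- The Hölder–Zygmund (Besov `B^γ_{∞,∞}`) norm `C_*^γ` (relative to a LP family `χ`). -/
def BesovNorm (χ : ℝ → ℝ) (γ : ℝ) (u : ℝ → ℂ) : ℝ≥0∞ :=
  LooNorm (LPlow χ u) ⊔
    ⨆ k : ℕ, ENNReal.ofReal ((2:ℝ) ^ (γ * ((k:ℝ) + 1))) * LooNorm (LP χ (k + 1) u)

/-- The fractional derivative `|∇|^s`: Fourier multiplier with symbol `|ξ|^s`. -/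
def fracD (s : ℝ) (u : ℝ → ℂ) : ℝ → ℂ :=
  𝓕⁻ (fun ξ => ((|ξ| ^ s : ℝ) : ℂ) * 𝓕 u ξ)

/-- The half-wave propagator `e^{-itΛ}`, `Λ = |∇|^{1/2}`. -/
def halfWave (t : ℝ) (u : ℝ → ℂ) : ℝ → ℂ :=
  𝓕⁻ (fun ξ => Complex.exp (-(t * Real.sqrt |ξ|) * Complex.I) * 𝓕 u ξ)

/-- `Ψ` is harmonic at the point `p` (of class `C²` with vanishing Laplacian). -/
def IsHarmonicAt (Ψ : ℝ × ℝ → ℝ) (p : ℝ × ℝ) : Prop :=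
  ContDiffAt ℝ 2 Ψ p ∧
    fderiv ℝ (fun q => fderiv ℝ Ψ q (1, 0)) p (1, 0)
      + fderiv ℝ (fun q => fderiv ℝ Ψ q (0, 1)) p (0, 1) = 0

/-- `g = G(h)ψ` is the Dirichlet-to-Neumann operator of the domain `{(x,y) : y < h(x)}`
applied to `ψ`: there is a bounded harmonic extension `Ψ` of `ψ` to the domain with
`g = √(1+h'²)·∂_nΨ = ∂_yΨ - h'·∂_xΨ` on the boundary graph. -/
def IsDtN (h ψ g : ℝ → ℝ) : Prop :=
  ∃ Ψ : ℝ × ℝ → ℝ,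
    (∀ p : ℝ × ℝ, p.2 < h p.1 → IsHarmonicAt Ψ p) ∧
    (∃ M : ℝ, ∀ p : ℝ × ℝ, p.2 ≤ h p.1 → |Ψ p| ≤ M) ∧
    ContinuousOn Ψ {p : ℝ × ℝ | p.2 ≤ h p.1} ∧
    (∀ x : ℝ, Ψ (x, h x) = ψ x) ∧
    (∀ x : ℝ, DifferentiableAt ℝ Ψ (x, h x) ∧
      g x = fderiv ℝ Ψ (x, h x) (0, 1) - deriv h x * fderiv ℝ Ψ (x, h x) (1, 0))

/-- `B = B(h)ψ = (G(h)ψ + h'ψ')/(1 + h'²)`, where `g = G(h)ψ`. -/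
def Bfun (h ψ g : ℝ → ℝ) : ℝ → ℝ :=
  fun x => (g x + deriv h x * deriv ψ x) / (1 + (deriv h x) ^ 2)

/-- `V = V(h)ψ = ψ' - h'·B(h)ψ`, where `g = G(h)ψ`. -/
def Vfun (h ψ g : ℝ → ℝ) : ℝ → ℝ :=
  fun x => deriv ψ x - deriv h x * Bfun h ψ g x

/-- An admissible paraproduct cutoff: smooth `φ(ξ₁,ξ₂)`, equal to `1` for
`|ξ₁| ≪ |ξ₂|`, `|ξ₂| ≫ 1` and to `0` for `|ξ₁| ≳ |ξ₂|` or `|ξ₂| ≲ 1`. -/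
structure ParaCutoff where
  φ : ℝ × ℝ → ℝ
  smooth : ContDiff ℝ (⊤ : ℕ∞) φ
  ε₁ : ℝ
  ε₂ : ℝ
  M₁ : ℝ
  M₂ : ℝ
  hε₁ : 0 < ε₁
  hε₁₂ : ε₁ < ε₂
  hM₁ : 0 < M₁
  hM₁₂ : M₁ < M₂
  eq_one : ∀ ξ₁ ξ₂ : ℝ, |ξ₁| ≤ ε₁ * |ξ₂| → M₂ ≤ |ξ₂| → φ (ξ₁, ξ₂) = 1
  eq_zero : ∀ ξ₁ ξ₂ : ℝ, ε₂ * |ξ₂| ≤ |ξ₁| ∨ |ξ₂| ≤ M₁ → φ (ξ₁, ξ₂) = 0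

/-- The paraproduct `T_f g` with cutoff `φ`. -/
def paraprod (φ : ℝ × ℝ → ℝ) (f g : ℝ → ℂ) : ℝ → ℂ :=
  𝓕⁻ (fun ξ => ∫ ξ₁ : ℝ, (φ (ξ₁, ξ - ξ₁) : ℂ) * 𝓕 f ξ₁ * 𝓕 g (ξ - ξ₁))

/-- The good unknown `w = ψ - T_B h`. -/
def wfun (φ : ℝ × ℝ → ℝ) (h ψ g : ℝ → ℝ) : ℝ → ℂ :=
  fun x => (ψ x : ℂ) - paraprod φ (cplx (Bfun h ψ g)) (cplx h) x

/-- `(h, ψ)` solves the gravity water wave system (Zakharov formulation) on `[0,T]`,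
with `g t = G(h(t))ψ(t)` the Dirichlet-to-Neumann term. -/
def IsWWSolution (T : ℝ) (h ψ g : ℝ → ℝ → ℝ) : Prop :=
  ∀ t ∈ Set.Icc (0:ℝ) T,
    IsDtN (h t) (ψ t) (g t) ∧
    ∀ x : ℝ,
      HasDerivAt (fun τ => h τ x) (g t x) t ∧
      HasDerivAt (fun τ => ψ τ x)
        (-(h t x) - (deriv (ψ t) x) ^ 2 / 2
          + (g t x + deriv (h t) x * deriv (ψ t) x) ^ 2
            / (2 * (1 + (deriv (h t) x) ^ 2))) t

/-- `t ↦ f t` belongs to `C([0,T], H^s)`. -/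
def ContInH (s T : ℝ) (f : ℝ → ℝ → ℂ) : Prop :=
  (∀ t ∈ Set.Icc (0:ℝ) T, HNorm s (f t) < ⊤) ∧
  ∀ t ∈ Set.Icc (0:ℝ) T,
    Tendsto (fun τ => HNorm s (fun x => f τ x - f t x))
      (nhdsWithin t (Set.Icc (0:ℝ) T)) (nhds 0)

/-- The phase `Φ_{μν}(ξ₁,ξ₂) = √|ξ₁+ξ₂| - μ√|ξ₁| - ν√|ξ₂|` (`μ, ν ∈ {1,-1}`). -/
def PhiFn (μ ν : ℝ) (ξ₁ ξ₂ : ℝ) : ℝ :=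
  Real.sqrt |ξ₁ + ξ₂| - μ * Real.sqrt |ξ₁| - ν * Real.sqrt |ξ₂|

/-- First basic quadratic symbol of the water wave nonlinearity. -/
def msym₁ (ξ₁ ξ₂ : ℝ) : ℝ :=
  (|ξ₁ + ξ₂| * |ξ₂| - (ξ₁ + ξ₂) * ξ₂) / Real.sqrt |ξ₂|

/-- Second basic quadratic symbol of the water wave nonlinearity. -/
def msym₂ (ξ₁ ξ₂ : ℝ) : ℝ :=
  Real.sqrt |ξ₁ + ξ₂| * (|ξ₁| * |ξ₂| + ξ₁ * ξ₂) / Real.sqrt (|ξ₁| * |ξ₂|)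

/-- A linear combination `a·m₁ + b·m₂` of the two basic quadratic symbols. -/
def msym (a b : ℂ) (ξ₁ ξ₂ : ℝ) : ℂ := a * (msym₁ ξ₁ ξ₂ : ℂ) + b * (msym₂ ξ₁ ξ₂ : ℂ)

/-- The bilinear Fourier multiplier with symbol `m(ξ₁,ξ₂)/(iΦ_{μν}(ξ₁,ξ₂))`. -/
def Qop (μ ν : ℝ) (m : ℝ → ℝ → ℂ) (f g : ℝ → ℂ) : ℝ → ℂ :=
  𝓕⁻ (fun ξ => ∫ ξ₁ : ℝ,
    m ξ₁ (ξ - ξ₁) / (Complex.I * (PhiFn μ ν ξ₁ (ξ - ξ₁) : ℂ)) * 𝓕 f ξ₁ * 𝓕 g (ξ - ξ₁))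

/-- `pick 1 u = u`, `pick (-1) u = conj u`. -/
def pick (μ : ℝ) (u : ℝ → ℂ) : ℝ → ℂ :=
  if μ = 1 then u else fun x => (starRingEnd ℂ) (u x)

/-- The complex unknown `u = h + i|∇|^{1/2}ψ`. -/
def uOf (h ψ : ℝ → ℝ) : ℝ → ℂ :=
  fun x => (h x : ℂ) + Complex.I * fracD (1/2) (cplx ψ) x

/-- The full nonlinearity `N = (G(h)-|∇|)ψ + (i/2)|∇|^{1/2}((1+h'²)B² - ψ'²)`. -/
def Nfun (h ψ g : ℝ → ℝ) : ℝ → ℂ := fun x =>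
  ((g x : ℂ) - fracD 1 (cplx ψ) x)
  + (Complex.I / 2) * fracD (1/2)
      (fun y => (((1 + (deriv h y) ^ 2) * (Bfun h ψ g y) ^ 2 - (deriv ψ y) ^ 2 : ℝ) : ℂ)) x

/-- The cubic remainder `B₃ = B - |∇|ψ + |∇|(h|∇|ψ) + hψ''`. -/
def B3fun (h ψ g : ℝ → ℝ) : ℝ → ℂ := fun x =>
  (Bfun h ψ g x : ℂ) - fracD 1 (cplx ψ) x
  + fracD 1 (fun y => (h y : ℂ) * fracD 1 (cplx ψ) y) x
  + (h x : ℂ) * ((deriv (deriv ψ) x : ℝ) : ℂ)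

/-- The cubic part `N₃ = B₃ + h'²B + (i/2)|∇|^{1/2}(B² - (|∇|ψ)² + h'²B²)`. -/
def N3fun (h ψ g : ℝ → ℝ) : ℝ → ℂ := fun x =>
  B3fun h ψ g x + (((deriv h x) ^ 2 * Bfun h ψ g x : ℝ) : ℂ)
  + (Complex.I / 2) * fracD (1/2)
      (fun y => ((Bfun h ψ g y : ℂ)) ^ 2 - (fracD 1 (cplx ψ) y) ^ 2
        + (((deriv h y) ^ 2 : ℝ) : ℂ) * ((Bfun h ψ g y : ℂ)) ^ 2) x

/-- `L⁴` norm in time on `[0,T]` of the `C_*^ρ` norm. -/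
def L4Besov (χ : ℝ → ℝ) (ρ T : ℝ) (u : ℝ → ℝ → ℂ) : ℝ≥0∞ :=
  (∫⁻ t in Set.Icc (0:ℝ) T, (BesovNorm χ ρ (u t)) ^ 4) ^ (1/4 : ℝ)

/-- The energy `E_s(t) = ‖h(t)‖_{H^s} + ‖|∇|^{1/2}w(t)‖_{H^s}`. -/
def Es (φ : ℝ × ℝ → ℝ) (s : ℝ) (h ψ g : ℝ → ℝ → ℝ) (t : ℝ) : ℝ≥0∞ :=
  HNorm s (cplx (h t)) + HNorm s (fracD (1/2) (wfun φ (h t) (ψ t) (g t)))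

/-- `F_s = sup_{t ∈ [0,T]} ‖u(t)‖_{H^s}`. -/
def FsSup (s T : ℝ) (u : ℝ → ℝ → ℂ) : ℝ≥0∞ :=
  ⨆ t ∈ Set.Icc (0:ℝ) T, HNorm s (u t)

/-- The cubic bulk bilinear term `C_{μν} = Q_{μν}[u_μ, N_ν] + Q_{μν}[N_μ, u_ν]`. -/
def Cop (μ ν : ℝ) (m : ℝ → ℝ → ℂ) (u N : ℝ → ℂ) : ℝ → ℂ := fun x =>
  Qop μ ν m (pick μ u) (pick ν N) x + Qop μ ν m (pick μ N) (pick ν u) x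

/-- First-derivative van der Corput estimate for an increasing positive phase derivative. -/
lemma norm_integral_cexp_le_of_le_deriv {ψ ψ' ψ'' : ℝ → ℝ} {a b μ : ℝ} (hab : a ≤ b)
    (h1 : ∀ x ∈ Set.Icc a b, HasDerivAt ψ (ψ' x) x)
    (h2 : ∀ x ∈ Set.Icc a b, HasDerivAt ψ' (ψ'' x) x)
    (h3 : ContinuousOn ψ'' (Set.Icc a b)) (hμ : 0 < μ)
    (hψ' : ∀ x ∈ Set.Icc a b, μ ≤ ψ' x) (hψ'' : ∀ x ∈ Set.Icc a b, 0 ≤ ψ'' x) :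
    ‖∫ x in a..b, cexp (ψ x * I)‖ ≤ 3 / μ := by
  have hpos : ∀ x ∈ Set.Icc a b, 0 < ψ' x := fun x hx => hμ.trans_le (hψ' x hx)
  have c1 : ContinuousOn ψ (Set.Icc a b) := fun x hx => (h1 x hx).continuousAt.continuousWithinAt
  have c2 : ContinuousOn ψ' (Set.Icc a b) := fun x hx => (h2 x hx).continuousAt.continuousWithinAt
  have hI : Set.uIcc a b = Set.Icc a b := Set.uIcc_of_le hab
  have cE : ContinuousOn (fun x => cexp (ψ x * I)) (Set.Icc a b) := by fun_prop
  have cR : ContinuousOn (fun x => ψ'' x / ψ' x ^ 2) (Set.Icc a b) :=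
    h3.div (c2.pow 2) fun x hx => (pow_pos (hpos x hx) 2).ne'
  have cG : ContinuousOn (fun x => cexp (ψ x * I) * ((ψ'' x / ψ' x ^ 2 : ℝ) : ℂ) * I)
      (Set.Icc a b) := by fun_prop
  have iE : IntervalIntegrable (fun x => cexp (ψ x * I)) volume a b :=
    (hI ▸ cE : ContinuousOn _ (Set.uIcc a b)).intervalIntegrable
  have iG : IntervalIntegrable (fun x => cexp (ψ x * I) * ((ψ'' x / ψ' x ^ 2 : ℝ) : ℂ) * I)
      volume a b := (hI ▸ cG : ContinuousOn _ (Set.uIcc a b)).intervalIntegrable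
  have iR : IntervalIntegrable (fun x => ψ'' x / ψ' x ^ 2) volume a b :=
    (hI ▸ cR : ContinuousOn _ (Set.uIcc a b)).intervalIntegrable
  have key : ∫ x in a..b, (cexp (ψ x * I) + cexp (ψ x * I) * ((ψ'' x / ψ' x ^ 2 : ℝ) : ℂ) * I) =
      cexp (ψ b * I) / (ψ' b * I) - cexp (ψ a * I) / (ψ' a * I) := by
    refine intervalIntegral.integral_eq_sub_of_hasDerivAt
      (f := fun x => cexp (ψ x * I) / (ψ' x * I)) (fun x hx => ?_) (iE.add iG)
    rw [hI] at hx
    have hne : (ψ' x : ℂ) ≠ 0 := by exact_mod_cast (hpos x hx).ne'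
    have d1 := (((h1 x hx).ofReal_comp).mul_const I).cexp
    have d2 := ((h2 x hx).ofReal_comp).mul_const I
    have d := d1.div d2 (mul_ne_zero hne I_ne_zero)
    refine d.congr_deriv ?_
    push_cast
    field_simp
    have : I ^ 2 = -1 := I_sq
    linear_combination (-(ψ'' x : ℂ)) * this
  have keyR : ∫ x in a..b, ψ'' x / ψ' x ^ 2 = -(ψ' b)⁻¹ - -(ψ' a)⁻¹ := by
    refine intervalIntegral.integral_eq_sub_of_hasDerivAt
      (f := fun x => -(ψ' x)⁻¹) (fun x hx => ?_) iR
    rw [hI] at hx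
    refine ((h2 x hx).inv (hpos x hx).ne').neg.congr_deriv ?_
    ring
  have hGle : ‖∫ x in a..b, cexp (ψ x * I) * ((ψ'' x / ψ' x ^ 2 : ℝ) : ℂ) * I‖ ≤ 1 / μ := by
    have : ‖∫ x in a..b, cexp (ψ x * I) * ((ψ'' x / ψ' x ^ 2 : ℝ) : ℂ) * I‖ ≤
        ∫ x in a..b, ψ'' x / ψ' x ^ 2 := by
      refine intervalIntegral.norm_integral_le_of_norm_le hab (ae_of_all _ fun x hx => ?_) iR
      have hx' : x ∈ Set.Icc a b := Set.Ioc_subset_Icc_self hx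
      have := div_nonneg (hψ'' x hx') (sq_nonneg (ψ' x))
      rw [norm_mul, norm_mul, norm_exp_ofReal_mul_I, norm_I, Complex.norm_real,
        Real.norm_of_nonneg this]
      simp
    refine this.trans ?_
    rw [keyR]
    have ha := hψ' a (Set.left_mem_Icc.2 hab)
    have hb := hpos b (Set.right_mem_Icc.2 hab)
    have e1 : (ψ' a)⁻¹ ≤ 1 / μ := by rw [one_div]; exact inv_anti₀ hμ ha
    have e2 : 0 < (ψ' b)⁻¹ := inv_pos.2 hb
    linarith
  have hbd : ∀ x ∈ Set.Icc a b, ‖cexp (ψ x * I) / (ψ' x * I)‖ ≤ 1 / μ := fun x hx => by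
    rw [norm_div, norm_mul, norm_exp_ofReal_mul_I, norm_I, Complex.norm_real,
      Real.norm_of_nonneg (hpos x hx).le, mul_one]
    exact one_div_le_one_div_of_le hμ (hψ' x hx)
  rw [intervalIntegral.integral_add iE iG] at key
  rw [eq_sub_of_add_eq key]
  refine (norm_sub_le _ _).trans ?_
  have := norm_sub_le (cexp (ψ b * I) / (ψ' b * I)) (cexp (ψ a * I) / (ψ' a * I))
  have := hbd a (Set.left_mem_Icc.2 hab)
  have := hbd b (Set.right_mem_Icc.2 hab)
  have e : 3 / μ = 1 / μ + 1 / μ + 1 / μ := by ring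
  linarith

lemma norm_integral_cexp_ofReal_mul_I_le {ψ : ℝ → ℝ} {a b : ℝ} (hab : a ≤ b) :
    ‖∫ x in a..b, cexp (ψ x * I)‖ ≤ b - a := by
  have := intervalIntegral.norm_integral_le_of_norm_le_const (a := a) (b := b) (C := 1)
    (f := fun x => cexp (ψ x * I)) fun x _ => (norm_exp_ofReal_mul_I _).le
  rwa [one_mul, abs_of_nonneg (sub_nonneg.2 hab)] at this

/-- Second-derivative van der Corput estimate for a phase that is increasing. -/
lemma norm_integral_cexp_le_of_deriv_nonneg {ψ ψ' ψ'' : ℝ → ℝ} {a b l : ℝ} (hab : a ≤ b)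
    (h1 : ∀ x ∈ Set.Icc a b, HasDerivAt ψ (ψ' x) x)
    (h2 : ∀ x ∈ Set.Icc a b, HasDerivAt ψ' (ψ'' x) x)
    (h3 : ContinuousOn ψ'' (Set.Icc a b)) (hl : 0 < l)
    (hψ'' : ∀ x ∈ Set.Icc a b, l ≤ ψ'' x) (ha : 0 ≤ ψ' a) :
    ‖∫ x in a..b, cexp (ψ x * I)‖ ≤ 4 / √l := by
  have hs : 0 < √l := Real.sqrt_pos.2 hl
  have hd : 0 < 1 / √l := by positivity
  have h14 : 1 / √l ≤ 4 / √l := by gcongr; norm_num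
  rcases le_total b (a + 1 / √l) with hb | hb
  · refine (norm_integral_cexp_ofReal_mul_I_le hab).trans ?_
    linarith
  have c1 : ContinuousOn ψ (Set.Icc a b) := fun x hx => (h1 x hx).continuousAt.continuousWithinAt
  have c2 : ContinuousOn ψ' (Set.Icc a b) := fun x hx => (h2 x hx).continuousAt.continuousWithinAt
  have cE : ContinuousOn (fun x => cexp (ψ x * I)) (Set.Icc a b) := by fun_prop
  have hac : a ≤ a + 1 / √l := by linarith
  have hsub : Set.Icc (a + 1 / √l) b ⊆ Set.Icc a b := Set.Icc_subset_Icc_left hac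
  rw [← intervalIntegral.integral_add_adjacent_intervals (b := a + 1 / √l)
    ((cE.mono (by rw [Set.uIcc_of_le hac]; exact Set.Icc_subset_Icc_right hb)).intervalIntegrable)
    ((cE.mono (by rw [Set.uIcc_of_le hb]; exact hsub)).intervalIntegrable)]
  refine (norm_add_le _ _).trans ?_
  have e1 := norm_integral_cexp_ofReal_mul_I_le (ψ := ψ) hac
  have hlow : ∀ x ∈ Set.Icc a b, l * (x - a) ≤ ψ' x := by
    intro x hx
    have hm : MonotoneOn (fun x => ψ' x - l * x) (Set.Icc a b) := by
      refine monotoneOn_of_deriv_nonneg (convex_Icc a b) (by fun_prop) ?_ ?_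
      · intro y hy
        have hy' := interior_subset hy
        exact ((h2 y hy').sub
          ((hasDerivAt_id y).const_mul l)).differentiableAt.differentiableWithinAt
      · intro y hy
        have hy' := interior_subset hy
        have := ((h2 y hy').sub ((hasDerivAt_id y).const_mul l)).deriv
        simp only [id] at this
        have h4 := hψ'' y hy'
        change 0 ≤ deriv (ψ' - fun y => l * y) y
        rw [this]; linarith
    have := hm (Set.left_mem_Icc.2 hab) hx hx.1
    simp only at this
    linarith
  have e2 : ‖∫ x in (a + 1 / √l)..b, cexp (ψ x * I)‖ ≤ 3 / √l := by
    refine norm_integral_cexp_le_of_le_deriv hb (fun x hx => h1 x (hsub hx))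
      (fun x hx => h2 x (hsub hx)) (h3.mono hsub) hs (fun x hx => ?_)
      fun x hx => hl.le.trans (hψ'' x (hsub hx))
    refine le_trans ?_ (hlow x (hsub hx))
    have : l * (1 / √l) ≤ l * (x - a) := mul_le_mul_of_nonneg_left (by linarith [hx.1]) hl.le
    refine le_trans (le_of_eq ?_) this
    rw [mul_one_div, Real.div_sqrt]
  have e : 4 / √l = 1 / √l + 3 / √l := by ring
  linarith

/-- Second-derivative van der Corput estimate. -/
lemma norm_integral_cexp_le_of_le_deriv2 {ψ ψ' ψ'' : ℝ → ℝ} {a b l : ℝ} (hab : a ≤ b)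
    (h1 : ∀ x ∈ Set.Icc a b, HasDerivAt ψ (ψ' x) x)
    (h2 : ∀ x ∈ Set.Icc a b, HasDerivAt ψ' (ψ'' x) x)
    (h3 : ContinuousOn ψ'' (Set.Icc a b)) (hl : 0 < l)
    (hψ'' : ∀ x ∈ Set.Icc a b, l ≤ ψ'' x) :
    ‖∫ x in a..b, cexp (ψ x * I)‖ ≤ 8 / √l := by
  have hs : 0 < √l := Real.sqrt_pos.2 hl
  have h48 : 4 / √l ≤ 8 / √l := by gcongr; norm_num
  have c1 : ContinuousOn ψ (Set.Icc a b) := fun x hx => (h1 x hx).continuousAt.continuousWithinAt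
  have c2 : ContinuousOn ψ' (Set.Icc a b) := fun x hx => (h2 x hx).continuousAt.continuousWithinAt
  have cE : ContinuousOn (fun x => cexp (ψ x * I)) (Set.Icc a b) := by fun_prop
  have neg_case : ∀ c ∈ Set.Icc a b, ψ' c ≤ 0 → ‖∫ x in a..c, cexp (ψ x * I)‖ ≤ 4 / √l := by
    intro c hc hc0
    have hm : ∀ x ∈ Set.Icc (-c) (-a), -x ∈ Set.Icc a b := fun x hx =>
      ⟨by linarith [hx.2], by linarith [hx.1, hc.2]⟩
    have := norm_integral_cexp_le_of_deriv_nonneg (ψ := fun x => ψ (-x)) (ψ' := fun x => -ψ' (-x))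
      (ψ'' := fun x => ψ'' (-x)) (a := -c) (b := -a) (l := l) (by linarith [hc.1])
      (fun x hx => ((h1 _ (hm x hx)).comp x (hasDerivAt_neg x)).congr_deriv (by ring))
      (fun x hx => (((h2 _ (hm x hx)).comp x (hasDerivAt_neg x)).neg).congr_deriv (by ring))
      (h3.comp continuous_neg.continuousOn hm) hl (fun x hx => hψ'' _ (hm x hx))
      (by simpa using hc0)
    have e := intervalIntegral.integral_comp_neg (a := -c) (b := -a)
      (fun x => cexp (ψ x * I))
    simp only [neg_neg] at e
    rwa [e] at this
  have pos_case : ∀ c ∈ Set.Icc a b, 0 ≤ ψ' c → ‖∫ x in c..b, cexp (ψ x * I)‖ ≤ 4 / √l := by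
    intro c hc hc0
    have hm : Set.Icc c b ⊆ Set.Icc a b := Set.Icc_subset_Icc_left hc.1
    exact norm_integral_cexp_le_of_deriv_nonneg hc.2 (fun x hx => h1 x (hm hx))
      (fun x hx => h2 x (hm hx)) (h3.mono hm) hl (fun x hx => hψ'' x (hm hx)) hc0
  rcases le_total 0 (ψ' a) with ha | ha
  · exact (pos_case a (Set.left_mem_Icc.2 hab) ha).trans h48
  rcases le_total (ψ' b) 0 with hb | hb
  · exact (neg_case b (Set.right_mem_Icc.2 hab) hb).trans h48
  obtain ⟨c, hc, hc0⟩ := intermediate_value_Icc hab c2 ⟨ha, hb⟩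
  rw [← intervalIntegral.integral_add_adjacent_intervals (b := c)
    (cE.mono (by rw [Set.uIcc_of_le hc.1]; exact Set.Icc_subset_Icc_right hc.2)).intervalIntegrable
    (cE.mono (by rw [Set.uIcc_of_le hc.2]; exact Set.Icc_subset_Icc_left hc.1)).intervalIntegrable]
  refine (norm_add_le _ _).trans ?_
  have e1 := neg_case c hc hc0.le
  have e2 := pos_case c hc hc0.ge
  have e : 8 / √l = 4 / √l + 4 / √l := by ring
  linarith

/-- Dispersive estimate for the half-wave kernel with frequencies in `(0, B]`, positive times. -/
lemma norm_integral_halfWave_kernel_le_of_pos {B t : ℝ} (hB : 0 < B) (ht : 0 < t) (y : ℝ) :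
    ‖∫ ξ in (0:ℝ)..B, cexp ((2 * π * y * ξ - t * √ξ : ℝ) * I)‖ ≤
      16 * B ^ (3/4 : ℝ) * t ^ (-(1/2) : ℝ) := by
  have cE : Continuous (fun ξ : ℝ => cexp ((2 * π * y * ξ - t * √ξ : ℝ) * I)) := by fun_prop
  refine le_of_forall_pos_le_add fun ε hε => ?_
  set δ := min ε B with hδ
  have hδ0 : 0 < δ := lt_min hε hB
  have hδB : δ ≤ B := min_le_right _ _
  rw [← intervalIntegral.integral_add_adjacent_intervals (b := δ)
    (cE.intervalIntegrable _ _) (cE.intervalIntegrable _ _)]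
  refine (norm_add_le _ _).trans ?_
  have e1 := norm_integral_cexp_ofReal_mul_I_le (ψ := fun ξ => 2 * π * y * ξ - t * √ξ) hδ0.le
  set l := t * (4 * B ^ (3/2 : ℝ))⁻¹ with hl
  have e2 : ‖∫ ξ in δ..B, cexp ((2 * π * y * ξ - t * √ξ : ℝ) * I)‖ ≤ 8 / √l := by
    have hx0 : ∀ x ∈ Set.Icc δ B, 0 < x := fun x hx => hδ0.trans_le hx.1
    refine norm_integral_cexp_le_of_le_deriv2 (ψ := fun ξ => 2 * π * y * ξ - t * √ξ)
      (ψ' := fun ξ => 2 * π * y - t * (1/2 * ξ ^ (-(1/2) : ℝ)))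
      (ψ'' := fun ξ => t * (1/4 * ξ ^ (-(3/2) : ℝ))) hδB ?_ ?_ ?_ (by positivity) ?_
    · intro x hx
      have h := (hasDerivAt_id x).const_mul (2 * π * y)
      have h' := ((Real.hasDerivAt_rpow_const (p := 1/2) (Or.inl (hx0 x hx).ne'))).const_mul t
      simp_rw [Real.sqrt_eq_rpow]
      refine (h.sub h').congr_deriv ?_
      norm_num
    · intro x hx
      have h' := (((Real.hasDerivAt_rpow_const (p := -(1/2)) (Or.inl (hx0 x hx).ne'))).const_mul
        (1/2)).const_mul t
      refine ((hasDerivAt_const x (2 * π * y)).sub h').congr_deriv ?_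
      rw [show (-(1/2) : ℝ) - 1 = -(3/2) by norm_num]
      ring
    · refine continuousOn_const.mul (continuousOn_const.mul ?_)
      exact continuousOn_id.rpow_const fun x hx => Or.inl (hx0 x hx).ne'
    · intro x hx
      have := hx0 x hx
      rw [hl, Real.rpow_neg this.le, mul_inv, one_div]
      gcongr
      exact hx.2
  have e3 : 8 / √l = 16 * B ^ (3/4 : ℝ) * t ^ (-(1/2) : ℝ) := by
    have h4 : √l = t ^ (1/2 : ℝ) * (2 * B ^ (3/4 : ℝ))⁻¹ := by
      rw [hl, Real.sqrt_mul ht.le, Real.sqrt_eq_rpow t, Real.sqrt_inv]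
      congr 2
      rw [Real.sqrt_eq_iff_mul_self_eq_of_pos (by positivity)]
      have : B ^ (3/2 : ℝ) = B ^ (3/4 : ℝ) * B ^ (3/4 : ℝ) := by
        rw [← Real.rpow_add hB]; norm_num
      rw [this]; ring
    rw [h4, Real.rpow_neg ht.le]
    have := Real.rpow_pos_of_pos ht (1/2)
    have := Real.rpow_pos_of_pos hB (3/4)
    field_simp
    norm_num
  rw [sub_zero] at e1
  rw [e3] at e2
  have := min_le_left ε B
  linarith

/-- Dispersive estimate for the half-wave kernel with frequencies in `(0, B]`. -/
lemma enorm_integral_halfWave_kernel_le {B : ℝ} (hB : 0 < B) (t y : ℝ) :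
    ‖∫ ξ in Set.Ioc (0:ℝ) B, cexp ((2 * π * y * ξ - t * √ξ : ℝ) * I)‖ₑ ≤
      ENNReal.ofReal (16 * B ^ (3/4 : ℝ)) * ENNReal.ofReal |t| ^ (-(1/2) : ℝ) := by
  have hC : 0 < 16 * B ^ (3/4 : ℝ) := by positivity
  rcases eq_or_ne t 0 with rfl | ht
  · rw [abs_zero, ENNReal.ofReal_zero, ENNReal.zero_rpow_of_neg (by norm_num), ENNReal.mul_top]
    · exact le_top
    · simpa using hC
  have key : ‖∫ ξ in Set.Ioc (0:ℝ) B, cexp ((2 * π * y * ξ - t * √ξ : ℝ) * I)‖ ≤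
      16 * B ^ (3/4 : ℝ) * |t| ^ (-(1/2) : ℝ) := by
    rw [← intervalIntegral.integral_of_le hB.le]
    rcases ht.lt_or_gt with h | h
    · have := norm_integral_halfWave_kernel_le_of_pos hB (neg_pos.2 h) (-y)
      rw [abs_of_neg h]
      refine le_trans (le_of_eq ?_) this
      rw [← RCLike.norm_conj, intervalIntegral.integral_of_le hB.le, ← integral_conj,
        ← intervalIntegral.integral_of_le hB.le]
      congr 2
      ext ξ
      rw [← Complex.exp_conj, map_mul, conj_I, Complex.conj_ofReal]
      congr 1
      push_cast
      ring
    · rw [abs_of_pos h]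
      exact norm_integral_halfWave_kernel_le_of_pos hB h y
  rw [ENNReal.ofReal_rpow_of_pos (abs_pos.2 ht), ← ENNReal.ofReal_mul hC.le, ← ofReal_norm]
  exact ENNReal.ofReal_le_ofReal key

lemma lintegral_Ioc_ofReal_rpow {p r : ℝ} (hp : -1 < p) (hr : 0 ≤ r) :
    ∫⁻ z in Set.Ioc 0 r, ENNReal.ofReal (z ^ p) = ENNReal.ofReal (r ^ (p + 1) / (p + 1)) := by
  have h := (intervalIntegrable_iff_integrableOn_Ioc_of_le hr).1
    (intervalIntegral.intervalIntegrable_rpow' (a := 0) (b := r) hp)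
  rw [← ofReal_integral_eq_lintegral_ofReal h, ← intervalIntegral.integral_of_le hr,
    integral_rpow (Or.inl hp), Real.zero_rpow (by linarith), sub_zero]
  filter_upwards [ae_restrict_mem measurableSet_Ioc] with z hz
  exact Real.rpow_nonneg hz.1.le _

lemma lintegral_ball_abs_sub_rpow_le {r : ℝ} (hr : 0 ≤ r) (x : ℝ) :
    ∫⁻ y in Metric.ball x r, ENNReal.ofReal |x - y| ^ (-(1/2) : ℝ) ≤
      4 * ENNReal.ofReal (r ^ (1/2 : ℝ)) := by
  set G : ℝ → ℝ≥0∞ := (Set.Ioc 0 r).indicator fun z => ENNReal.ofReal (z ^ (-(1/2) : ℝ)) with hG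
  have hGm : Measurable G := by
    refine Measurable.indicator ?_ measurableSet_Ioc
    fun_prop
  have hGi : ∫⁻ z, G z = 2 * ENNReal.ofReal (r ^ (1/2 : ℝ)) := by
    rw [hG, lintegral_indicator measurableSet_Ioc, lintegral_Ioc_ofReal_rpow (by norm_num) hr,
      show (2 : ℝ≥0∞) = ENNReal.ofReal 2 by simp, ← ENNReal.ofReal_mul (by norm_num)]
    congr 1
    norm_num
    ring
  have hle : ∫⁻ y in Metric.ball x r, ENNReal.ofReal |x - y| ^ (-(1/2) : ℝ) ≤
      ∫⁻ y, (G (x - y) + G (-(x - y))) := by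
    rw [← lintegral_indicator Metric.isOpen_ball.measurableSet]
    refine lintegral_mono_ae ?_
    filter_upwards [compl_mem_ae_iff.2 (measure_singleton x)] with y hy
    have hy : x - y ≠ 0 := sub_ne_zero.2 fun h => hy h.symm
    by_cases hb : y ∈ Metric.ball x r
    · rw [Set.indicator_of_mem hb, ENNReal.ofReal_rpow_of_pos (abs_pos.2 hy)]
      rw [Metric.mem_ball, Real.dist_eq, abs_sub_comm] at hb
      rcases hy.lt_or_gt with h | h
      · rw [abs_of_neg h] at hb ⊢
        rw [hG, Set.indicator_of_mem (a := -(x - y)) (by constructor <;> linarith)]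
        exact le_add_self
      · rw [abs_of_pos h] at hb ⊢
        rw [hG, Set.indicator_of_mem (a := (x - y)) (by constructor <;> linarith)]
        exact le_self_add
    · rw [Set.indicator_of_notMem hb]
      exact zero_le
  refine hle.trans (le_of_eq ?_)
  rw [lintegral_add_left (by fun_prop), lintegral_sub_left_eq_self G x,
    lintegral_sub_left_eq_self (fun z => G (-z)) x, lintegral_neg_eq_self, hGi, ← add_mul]
  norm_num

lemma setLIntegral_abs_sub_rpow_le {E : Set ℝ} (hE : MeasurableSet E) (x : ℝ) :
    ∫⁻ y in E, ENNReal.ofReal |x - y| ^ (-(1/2) : ℝ) ≤ 5 * volume E ^ (1/2 : ℝ) := by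
  rcases eq_or_ne (volume E) ⊤ with hT | hT
  · rw [hT, ENNReal.top_rpow_of_pos (by norm_num), ENNReal.mul_top (by norm_num)]
    exact le_top
  rcases eq_or_ne (volume E) 0 with h0 | h0
  · rw [Measure.restrict_eq_zero.2 h0]
    simp
  set r := (volume E).toReal with hr
  have hr0 : 0 < r := ENNReal.toReal_pos h0 hT
  have hrE : volume E = ENNReal.ofReal r := (ENNReal.ofReal_toReal hT).symm
  have hsub : E ⊆ Metric.ball x r ∪ (E \ Metric.ball x r) := by
    intro y hy
    by_cases h : y ∈ Metric.ball x r
    · exact Or.inl h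
    · exact Or.inr ⟨hy, h⟩
  refine (lintegral_mono_set hsub).trans ((lintegral_union_le _ _ _).trans ?_)
  have h2 : ∫⁻ y in E \ Metric.ball x r, ENNReal.ofReal |x - y| ^ (-(1/2) : ℝ) ≤
      ENNReal.ofReal (r ^ (1/2 : ℝ)) := by
    calc ∫⁻ y in E \ Metric.ball x r, ENNReal.ofReal |x - y| ^ (-(1/2) : ℝ)
        ≤ ∫⁻ y in E \ Metric.ball x r, ENNReal.ofReal (r ^ (-(1/2) : ℝ)) := by
          refine setLIntegral_mono' (hE.diff Metric.isOpen_ball.measurableSet) fun y hy => ?_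
          have : r ≤ |x - y| := by
            have := hy.2
            rw [Metric.mem_ball, Real.dist_eq, abs_sub_comm, not_lt] at this
            exact this
          rw [ENNReal.ofReal_rpow_of_pos (hr0.trans_le this)]
          exact ENNReal.ofReal_le_ofReal (Real.rpow_le_rpow_of_nonpos hr0 this (by norm_num))
      _ = ENNReal.ofReal (r ^ (-(1/2) : ℝ)) * volume (E \ Metric.ball x r) := by
          rw [setLIntegral_const]
      _ ≤ ENNReal.ofReal (r ^ (-(1/2) : ℝ)) * ENNReal.ofReal r := by
          gcongr
          rw [← hrE]
          exact measure_mono Set.sdiff_subset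
      _ = ENNReal.ofReal (r ^ (1/2 : ℝ)) := by
          rw [← ENNReal.ofReal_mul (by positivity)]
          congr 1
          rw [← Real.rpow_add_one hr0.ne']
          norm_num
  refine (add_le_add (lintegral_ball_abs_sub_rpow_le hr0.le x) h2).trans (le_of_eq ?_)
  rw [hrE, ENNReal.ofReal_rpow_of_pos hr0]
  ring

/-- Layer-cake formula against a weight. -/
lemma lintegral_ofReal_mul_eq_lintegral_setLIntegral {α : Type*} [MeasurableSpace α]
    {μ : Measure α} {f : α → ℝ} (hf : Measurable f) (h0 : ∀ x, 0 ≤ f x)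
    {G : α → ℝ≥0∞} (hG : Measurable G) :
    ∫⁻ x, ENNReal.ofReal (f x) * G x ∂μ =
      ∫⁻ a in Set.Ioi (0:ℝ), ∫⁻ x in {x | a < f x}, G x ∂μ := by
  have h := lintegral_eq_lintegral_meas_lt (μ.withDensity G) (ae_of_all _ h0) hf.aemeasurable
  rw [lintegral_withDensity_eq_lintegral_mul _ hG (by fun_prop)] at h
  simp only [Pi.mul_apply] at h
  simp_rw [mul_comm (ENNReal.ofReal _)]
  rw [h]
  refine lintegral_congr fun a => ?_
  rw [withDensity_apply _ (measurableSet_lt measurable_const hf)]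

/-- The Hardy–Littlewood–Sobolev inequality on the line for the kernel `|x - y| ^ (-1/2)`. -/
lemma lintegral_lintegral_mul_abs_sub_rpow_le {f : ℝ → ℝ} (hf : Measurable f)
    (h0 : ∀ x, 0 ≤ f x) :
    ∫⁻ x, ENNReal.ofReal (f x) * ∫⁻ y, ENNReal.ofReal (f y) *
        ENNReal.ofReal |x - y| ^ (-(1/2) : ℝ) ≤
      30 * (∫⁻ x, ENNReal.ofReal (f x ^ (4/3 : ℝ))) ^ (3/2 : ℝ) := by
  set K := ∫⁻ x, ENNReal.ofReal (f x ^ (4/3 : ℝ)) with hK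
  set u : ℝ → ℝ≥0∞ := fun a => volume {x | a < f x} with hu
  have hE : ∀ a, MeasurableSet {x | a < f x} := fun a => measurableSet_lt measurable_const hf
  have hum : Measurable u := by
    refine Antitone.measurable fun a b hab => measure_mono fun x (hx : b < f x) => ?_
    exact hab.trans_lt hx
  have hkm : Measurable fun p : ℝ × ℝ => ENNReal.ofReal |p.1 - p.2| ^ (-(1/2) : ℝ) := by fun_prop
  set F : ℝ → ℝ → ℝ≥0∞ := fun a b => if a ≤ b then 5 * u a ^ (1/2 : ℝ) * u b else 0 with hF
  have hFm : Measurable (Function.uncurry F) := by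
    refine Measurable.ite (measurableSet_le measurable_fst measurable_snd) ?_ measurable_const
    fun_prop
  have hJ1 : ∀ a b, ∫⁻ x in {x | a < f x}, ∫⁻ y in {y | b < f y},
      ENNReal.ofReal |x - y| ^ (-(1/2) : ℝ) ≤ 5 * u b ^ (1/2 : ℝ) * u a := fun a b => by
    refine (lintegral_mono fun x => setLIntegral_abs_sub_rpow_le (hE b) x).trans (le_of_eq ?_)
    rw [setLIntegral_const]
  have hJ : ∀ a b, ∫⁻ x in {x | a < f x}, ∫⁻ y in {y | b < f y},
      ENNReal.ofReal |x - y| ^ (-(1/2) : ℝ) ≤ F a b + F b a := fun a b => by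
    rcases le_total a b with hab | hab
    · refine le_trans ?_ le_self_add
      rw [hF]
      simp only [hab, if_true]
      rw [lintegral_lintegral_swap hkm.aemeasurable]
      refine le_trans (le_of_eq ?_) (hJ1 b a)
      simp_rw [abs_sub_comm]
    · refine le_trans ?_ le_add_self
      rw [hF]
      simp only [hab, if_true]
      exact hJ1 a b
  have hcheb : ∀ a, 0 < a → u a ^ (1/2 : ℝ) ≤
      K ^ (1/2 : ℝ) * ENNReal.ofReal (a ^ (-(2/3) : ℝ)) := fun a ha => by
    have h1 : ENNReal.ofReal (a ^ (4/3 : ℝ)) * u a ≤ K := by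
      refine le_trans ?_ (mul_meas_ge_le_lintegral (f := fun x => ENNReal.ofReal (f x ^ (4/3 : ℝ)))
        (by fun_prop) (ENNReal.ofReal (a ^ (4/3 : ℝ))))
      gcongr
      refine measure_mono fun x (hx : a < f x) => ?_
      exact ENNReal.ofReal_le_ofReal (Real.rpow_le_rpow ha.le hx.le (by norm_num))
    have h2 : u a ≤ K * ENNReal.ofReal (a ^ (-(4/3) : ℝ)) := by
      calc u a = ENNReal.ofReal (a ^ (4/3 : ℝ)) * u a * ENNReal.ofReal (a ^ (-(4/3) : ℝ)) := by
            rw [mul_right_comm, ← ENNReal.ofReal_mul (by positivity), ← Real.rpow_add ha]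
            norm_num
        _ ≤ _ := by gcongr
    refine (ENNReal.rpow_le_rpow h2 (by norm_num)).trans (le_of_eq ?_)
    rw [ENNReal.mul_rpow_of_nonneg _ _ (by norm_num),
      ENNReal.ofReal_rpow_of_pos (by positivity), ← Real.rpow_mul ha.le]
    norm_num
  have hw : ∀ b, 0 < b → ∫⁻ a in Set.Ioi 0, F a b ≤
      15 * K ^ (1/2 : ℝ) * (u b * ENNReal.ofReal (b ^ (4/3 - 1 : ℝ))) := fun b hb => by
    calc ∫⁻ a in Set.Ioi 0, F a b
        ≤ ∫⁻ a in Set.Ioi 0, (Set.Ioc 0 b).indicator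
            (fun a => 5 * u b * K ^ (1/2 : ℝ) * ENNReal.ofReal (a ^ (-(2/3) : ℝ))) a := by
          refine setLIntegral_mono' measurableSet_Ioi fun a (ha : 0 < a) => ?_
          by_cases hab : a ≤ b
          · rw [Set.indicator_of_mem (Set.mem_Ioc.2 ⟨ha, hab⟩), hF]
            simp only [hab, if_true]
            calc 5 * u a ^ (1/2 : ℝ) * u b
                ≤ 5 * (K ^ (1/2 : ℝ) * ENNReal.ofReal (a ^ (-(2/3) : ℝ))) * u b := by
                  gcongr; exact hcheb a ha
              _ = _ := by ring
          · simp [hF, hab]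
      _ ≤ ∫⁻ a, (Set.Ioc 0 b).indicator
            (fun a => 5 * u b * K ^ (1/2 : ℝ) * ENNReal.ofReal (a ^ (-(2/3) : ℝ))) a :=
          setLIntegral_le_lintegral _ _
      _ = _ := by
          rw [lintegral_indicator measurableSet_Ioc, lintegral_const_mul _ (by fun_prop),
            lintegral_Ioc_ofReal_rpow (by norm_num) hb.le]
          have : b ^ (-(2/3) + 1 : ℝ) / (-(2/3) + 1) = 3 * b ^ (4/3 - 1 : ℝ) := by
            norm_num; ring
          rw [this, ENNReal.ofReal_mul (by norm_num)]
          norm_num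
          ring
  have hKu : ∫⁻ b in Set.Ioi 0, u b * ENNReal.ofReal (b ^ (4/3 - 1 : ℝ)) ≤ K := by
    rw [hK, lintegral_rpow_eq_lintegral_meas_lt_mul volume (ae_of_all _ h0) hf.aemeasurable
      (by norm_num : (0:ℝ) < 4/3)]
    refine le_mul_of_one_le_left zero_le ?_
    rw [← ENNReal.ofReal_one]
    exact ENNReal.ofReal_le_ofReal (by norm_num)
  have hFF : ∫⁻ b in Set.Ioi (0:ℝ), ∫⁻ a in Set.Ioi (0:ℝ), F a b ≤ 15 * K ^ (3/2 : ℝ) := by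
    calc ∫⁻ b in Set.Ioi (0:ℝ), ∫⁻ a in Set.Ioi (0:ℝ), F a b
        ≤ ∫⁻ b in Set.Ioi (0:ℝ),
            15 * K ^ (1/2 : ℝ) * (u b * ENNReal.ofReal (b ^ (4/3 - 1 : ℝ))) :=
          setLIntegral_mono' measurableSet_Ioi hw
      _ ≤ 15 * K ^ (1/2 : ℝ) * K := by
          rw [lintegral_const_mul _ (by fun_prop)]
          gcongr
      _ = 15 * K ^ (3/2 : ℝ) := by
          rw [mul_assoc]
          congr 1
          conv_lhs => rw [← ENNReal.rpow_one K, ← ENNReal.rpow_mul]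
          rw [← ENNReal.rpow_add_of_nonneg _ _ (by norm_num) (by norm_num)]
          norm_num
  have hΦ : ∀ x, ∫⁻ y, ENNReal.ofReal (f y) * ENNReal.ofReal |x - y| ^ (-(1/2) : ℝ) =
      ∫⁻ b in Set.Ioi (0:ℝ), ∫⁻ y in {y | b < f y}, ENNReal.ofReal |x - y| ^ (-(1/2) : ℝ) :=
    fun x => lintegral_ofReal_mul_eq_lintegral_setLIntegral hf h0 (by fun_prop)
  have hκ : Measurable (Function.uncurry fun x b : ℝ =>
      ∫⁻ y in {y | b < f y}, ENNReal.ofReal |x - y| ^ (-(1/2) : ℝ)) := by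
    simp_rw [← lintegral_indicator (hE _)]
    refine Measurable.lintegral_prod_right' (f := fun p : (ℝ × ℝ) × ℝ =>
      ({y | p.1.2 < f y}).indicator (fun y => ENNReal.ofReal |p.1.1 - y| ^ (-(1/2) : ℝ)) p.2) ?_
    have : (fun p : (ℝ × ℝ) × ℝ =>
      ({y | p.1.2 < f y}).indicator (fun y => ENNReal.ofReal |p.1.1 - y| ^ (-(1/2) : ℝ)) p.2) =
      ({p : (ℝ × ℝ) × ℝ | p.1.2 < f p.2}).indicator
        (fun p => ENNReal.ofReal |p.1.1 - p.2| ^ (-(1/2) : ℝ)) := by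
      ext p; simp [Set.indicator]
    rw [this]
    refine Measurable.indicator (by fun_prop) (measurableSet_lt (by fun_prop) (by fun_prop))
  calc _ = ∫⁻ a in Set.Ioi (0:ℝ), ∫⁻ x in {x | a < f x}, ∫⁻ b in Set.Ioi (0:ℝ),
          ∫⁻ y in {y | b < f y}, ENNReal.ofReal |x - y| ^ (-(1/2) : ℝ) := by
        simp_rw [hΦ]
        exact lintegral_ofReal_mul_eq_lintegral_setLIntegral hf h0 hκ.lintegral_prod_right'
    _ = ∫⁻ a in Set.Ioi (0:ℝ), ∫⁻ b in Set.Ioi (0:ℝ), ∫⁻ x in {x | a < f x},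
          ∫⁻ y in {y | b < f y}, ENNReal.ofReal |x - y| ^ (-(1/2) : ℝ) :=
        lintegral_congr fun a => lintegral_lintegral_swap hκ.aemeasurable
    _ ≤ ∫⁻ a in Set.Ioi (0:ℝ), ∫⁻ b in Set.Ioi (0:ℝ), (F a b + F b a) :=
        lintegral_mono fun a => lintegral_mono fun b => hJ a b
    _ = (∫⁻ a in Set.Ioi (0:ℝ), ∫⁻ b in Set.Ioi (0:ℝ), F a b) +
          ∫⁻ a in Set.Ioi (0:ℝ), ∫⁻ b in Set.Ioi (0:ℝ), F b a := by
        have hm : Measurable fun a => ∫⁻ b in Set.Ioi (0:ℝ), F a b := hFm.lintegral_prod_right'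
        rw [← lintegral_add_left hm]
        refine lintegral_congr fun a => lintegral_add_left ?_ _
        exact hFm.comp (measurable_const.prodMk measurable_id)
    _ ≤ 15 * K ^ (3/2 : ℝ) + 15 * K ^ (3/2 : ℝ) := by
        refine add_le_add ?_ hFF
        rw [lintegral_lintegral_swap hFm.aemeasurable]
        exact hFF
    _ = _ := by rw [← add_mul]; norm_num

/-- The half-wave evolution with Fourier data `g` on the positive frequencies `(0, B]`. -/
def posHalfWave (B : ℝ) (g : ℝ → ℂ) (t x : ℝ) : ℂ :=
  ∫ ξ in Set.Ioc (0:ℝ) B, cexp ((2 * π * x * ξ - t * √ξ : ℝ) * I) * g ξ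

lemma continuous_posHalfWave {B : ℝ} {g : ℝ → ℂ} (hg : IntegrableOn g (Set.Ioc 0 B)) :
    Continuous fun p : ℝ × ℝ => posHalfWave B g p.1 p.2 := by
  refine continuous_of_dominated (bound := fun ξ => ‖g ξ‖) (fun p => ?_) (fun p => ?_) hg.norm ?_
  · exact (by fun_prop : Continuous fun ξ : ℝ =>
      cexp ((2 * π * p.2 * ξ - p.1 * √ξ : ℝ) * I)).aestronglyMeasurable.mul hg.1
  · refine ae_of_all _ fun ξ => ?_
    rw [norm_mul, norm_exp_ofReal_mul_I, one_mul]
  · refine ae_of_all _ fun ξ => ?_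
    fun_prop

lemma norm_posHalfWave_le {B : ℝ} {g : ℝ → ℂ} (t x : ℝ) :
    ‖posHalfWave B g t x‖ ≤ ∫ ξ in Set.Ioc 0 B, ‖g ξ‖ := by
  refine (norm_integral_le_integral_norm _).trans (le_of_eq ?_)
  refine integral_congr_ae (ae_of_all _ fun ξ => ?_)
  simp only
  rw [norm_mul, norm_exp_ofReal_mul_I, one_mul]

/-- The dual Strichartz estimate along a measurable curve `t ↦ x t`. -/
lemma lintegral_enorm_integral_halfWave_dual_le {B : ℝ} (hB : 0 < B) {x : ℝ → ℝ}
    (hx : Measurable x) {h : ℝ → ℂ} (hm : Measurable h) (hi : Integrable h) :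
    ∫⁻ ξ in Set.Ioc 0 B, ‖∫ t, h t * cexp ((2 * π * x t * ξ - t * √ξ : ℝ) * I)‖ₑ ^ 2 ≤
      ENNReal.ofReal (16 * B ^ (3/4 : ℝ)) *
        (30 * (∫⁻ t, ENNReal.ofReal (‖h t‖ ^ (4/3 : ℝ))) ^ (3/2 : ℝ)) := by
  set ν := volume.restrict (Set.Ioc 0 B) with hν
  set H : ℝ → ℂ := fun ξ => ∫ t, h t * cexp ((2 * π * x t * ξ - t * √ξ : ℝ) * I) with hH
  set Φ : ℝ → ℝ × ℝ → ℂ := fun ξ p =>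
    cexp ((2 * π * (x p.1 - x p.2) * ξ - (p.1 - p.2) * √ξ : ℝ) * I) *
      (h p.1 * (starRingEnd ℂ) (h p.2)) with hΦ
  have hΦi : Integrable (Function.uncurry Φ) (ν.prod (volume.prod volume)) := by
    have h1 : Integrable (fun p : ℝ × ℝ => h p.1 * (starRingEnd ℂ) (h p.2))
        (volume.prod volume) := by
      have hcm : Measurable fun t => (starRingEnd ℂ) (h t) :=
        Complex.continuous_conj.measurable.comp hm
      have hci : Integrable fun t => (starRingEnd ℂ) (h t) :=
        hi.mono hcm.aestronglyMeasurable (ae_of_all _ fun t => (RCLike.norm_conj _).le)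
      exact hi.mul_prod hci
    refine (h1.comp_snd ν).bdd_mul (c := 1) ?_ (ae_of_all _ fun q => (norm_exp_ofReal_mul_I _).le)
    refine Measurable.aestronglyMeasurable ?_
    fun_prop
  have hHΦ : ∀ ξ, H ξ * (starRingEnd ℂ) (H ξ) = ∫ p, Φ ξ p ∂(volume.prod volume) := fun ξ => by
    rw [hH]
    simp only
    rw [← integral_conj, ← integral_prod_mul]
    refine integral_congr_ae (ae_of_all _ fun p => ?_)
    simp only [hΦ, map_mul]
    rw [← Complex.exp_conj, map_mul, conj_I, Complex.conj_ofReal, mul_mul_mul_comm,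
      ← Complex.exp_add, mul_comm]
    congr 2
    push_cast
    ring
  have hHm : AEStronglyMeasurable H ν := by
    refine AEStronglyMeasurable.integral_prod_right' (f := fun q : ℝ × ℝ =>
      h q.2 * cexp ((2 * π * x q.2 * q.1 - q.2 * √q.1 : ℝ) * I)) ?_
    refine Measurable.aestronglyMeasurable ?_
    fun_prop
  have hsq : ∀ ξ, ‖H ξ * (starRingEnd ℂ) (H ξ)‖ₑ = ‖H ξ‖ₑ ^ 2 := fun ξ => by
    rw [enorm_mul, RCLike.enorm_conj, sq]
  have hHi : Integrable (fun ξ => H ξ * (starRingEnd ℂ) (H ξ)) ν := by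
    simp_rw [hHΦ]
    exact hΦi.integral_prod_left
  have hker : ∀ p : ℝ × ℝ, ‖∫ ξ, Φ ξ p ∂ν‖ₑ ≤ ENNReal.ofReal (16 * B ^ (3/4 : ℝ)) *
      (ENNReal.ofReal ‖h p.1‖ * (ENNReal.ofReal ‖h p.2‖ *
        ENNReal.ofReal |p.1 - p.2| ^ (-(1/2) : ℝ))) := fun p => by
    simp only [hΦ]
    rw [integral_mul_const, enorm_mul, enorm_mul, RCLike.enorm_conj]
    rw [← ofReal_norm (h p.1), ← ofReal_norm (h p.2)]
    refine (mul_le_mul_left (enorm_integral_halfWave_kernel_le hB (p.1 - p.2) (x p.1 - x p.2))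
      _).trans (le_of_eq ?_)
    ring
  calc ∫⁻ ξ, ‖H ξ‖ₑ ^ 2 ∂ν = ‖∫ ξ, H ξ * (starRingEnd ℂ) (H ξ) ∂ν‖ₑ := by
        have hre : ∀ ξ, H ξ * (starRingEnd ℂ) (H ξ) = ((‖H ξ‖ ^ 2 : ℝ) : ℂ) := fun ξ => by
          rw [mul_conj, normSq_eq_norm_sq]
        simp_rw [← hsq]
        rw [← ofReal_integral_norm_eq_lintegral_enorm hHi]
        simp_rw [hre]
        rw [integral_complex_ofReal, ← ofReal_norm, Complex.norm_real, Real.norm_of_nonneg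
          (integral_nonneg fun ξ => by positivity)]
        congr 1
        refine integral_congr_ae (ae_of_all _ fun ξ => ?_)
        simp
    _ = ‖∫ p, ∫ ξ, Φ ξ p ∂ν ∂(volume.prod volume)‖ₑ := by
        simp_rw [hHΦ]
        rw [integral_integral_swap hΦi]
    _ ≤ ∫⁻ p, ‖∫ ξ, Φ ξ p ∂ν‖ₑ ∂(volume.prod volume) := enorm_integral_le_lintegral_enorm _
    _ ≤ ∫⁻ p : ℝ × ℝ, ENNReal.ofReal (16 * B ^ (3/4 : ℝ)) *
          (ENNReal.ofReal ‖h p.1‖ * (ENNReal.ofReal ‖h p.2‖ *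
            ENNReal.ofReal |p.1 - p.2| ^ (-(1/2) : ℝ))) ∂(volume.prod volume) :=
        lintegral_mono hker
    _ = ENNReal.ofReal (16 * B ^ (3/4 : ℝ)) * ∫⁻ t, ENNReal.ofReal ‖h t‖ *
          ∫⁻ s, ENNReal.ofReal ‖h s‖ * ENNReal.ofReal |t - s| ^ (-(1/2) : ℝ) := by
        rw [lintegral_const_mul _ (by fun_prop), lintegral_prod _ (by fun_prop)]
        congr 1
        refine lintegral_congr fun t => ?_
        simp only
        rw [lintegral_const_mul _ (by fun_prop)]
    _ ≤ _ := by
        gcongr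
        exact lintegral_lintegral_mul_abs_sub_rpow_le (f := fun t => ‖h t‖) (by fun_prop)
          fun t => norm_nonneg _

lemma ENNReal.le_sq_of_le_rpow_mul {A G : ℝ≥0∞} (hA : A ≠ ⊤)
    (h : A ≤ G ^ (1/2 : ℝ) * (A ^ (3/2 : ℝ)) ^ (1/2 : ℝ)) : A ≤ G ^ 2 := by
  rcases eq_or_ne A 0 with rfl | h0
  · exact zero_le
  have e : A ^ (1/4 : ℝ) ≤ G ^ (1/2 : ℝ) := by
    rw [← ENNReal.rpow_mul] at h
    have h1 : A ^ (1/4 : ℝ) = A * A ^ (-(3/4) : ℝ) := by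
      conv_rhs => rw [← ENNReal.rpow_one A, ← ENNReal.rpow_mul, ← ENNReal.rpow_add _ _ h0 hA]
      norm_num
    calc A ^ (1/4 : ℝ) = A * A ^ (-(3/4) : ℝ) := h1
      _ ≤ G ^ (1/2 : ℝ) * A ^ (3/2 * (1/2) : ℝ) * A ^ (-(3/4) : ℝ) := by gcongr
      _ = G ^ (1/2 : ℝ) := by
          rw [mul_assoc, ← ENNReal.rpow_add _ _ h0 hA]
          norm_num
  have := ENNReal.rpow_le_rpow e (by norm_num : (0:ℝ) ≤ 4)
  rw [← ENNReal.rpow_mul, ← ENNReal.rpow_mul] at this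
  norm_num at this
  exact_mod_cast this

/-- Strichartz estimate along a measurable curve, on a bounded time interval. -/
lemma setLIntegral_enorm_posHalfWave_curve_le {B : ℝ} (hB : 0 < B) {g : ℝ → ℂ}
    (hg : IntegrableOn g (Set.Ioc 0 B)) {x : ℝ → ℝ} (hx : Measurable x) (R : ℝ) :
    ∫⁻ t in Set.Icc (-R) R, ‖posHalfWave B g t (x t)‖ₑ ^ 4 ≤
      (30 * ENNReal.ofReal (16 * B ^ (3/4 : ℝ)) * ∫⁻ ξ in Set.Ioc 0 B, ‖g ξ‖ₑ ^ 2) ^ 2 := by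
  set ν := volume.restrict (Set.Ioc 0 B) with hν
  have hφm : Measurable fun t => posHalfWave B g t (x t) := by
    have hc := (continuous_posHalfWave hg).measurable
    exact hc.comp (g := fun p : ℝ × ℝ => posHalfWave B g p.1 p.2) (f := fun t => (t, x t))
      (measurable_id.prodMk hx)
  set φ : ℝ → ℂ := fun t => posHalfWave B g t (x t) with hφ
  set M := ∫ ξ in Set.Ioc 0 B, ‖g ξ‖ with hM
  have hM0 : 0 ≤ M := integral_nonneg fun ξ => norm_nonneg _
  have hφM : ∀ t, ‖φ t‖ ≤ M := fun t => norm_posHalfWave_le _ _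
  set S := Set.Icc (-R) R with hS
  have hSm : MeasurableSet S := measurableSet_Icc
  set h : ℝ → ℂ := S.indicator fun t => (starRingEnd ℂ) (φ t) * ((‖φ t‖ ^ 2 : ℝ) : ℂ) with hh
  have hhm : Measurable h := Measurable.indicator (by fun_prop) hSm
  have hhi : Integrable h := by
    rw [hh, integrable_indicator_iff hSm]
    refine Measure.integrableOn_of_bounded (M := M * M ^ 2) (by simp [hS]) (by fun_prop)
      (ae_of_all _ fun t => ?_)
    rw [norm_mul, RCLike.norm_conj, Complex.norm_real, Real.norm_of_nonneg (by positivity)]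
    gcongr <;> exact hφM t
  set A := ∫⁻ t in S, ‖φ t‖ₑ ^ 4 with hA
  have hAfin : A ≠ ⊤ := by
    refine ne_top_of_le_ne_top ?_ (setLIntegral_mono' (g := fun _ => ENNReal.ofReal M ^ 4) hSm
      fun t _ => ?_)
    · rw [setLIntegral_const]
      exact ENNReal.mul_ne_top (by simp) (by simp [hS])
    · rw [← ofReal_norm]
      gcongr
      exact hφM t
  have hA43 : ∫⁻ t, ENNReal.ofReal (‖h t‖ ^ (4/3 : ℝ)) = A := by
    rw [hA, ← lintegral_indicator hSm]
    refine lintegral_congr fun t => ?_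
    by_cases ht : t ∈ S
    · rw [hh, Set.indicator_of_mem ht, Set.indicator_of_mem ht, norm_mul, RCLike.norm_conj,
        Complex.norm_real, Real.norm_of_nonneg (by positivity), ← pow_succ',
        ← ofReal_norm, ← ENNReal.ofReal_pow (norm_nonneg _), ← Real.rpow_natCast,
        ← Real.rpow_mul (norm_nonneg _)]
      norm_num
    · rw [hh, Set.indicator_of_notMem ht, Set.indicator_of_notMem ht, norm_zero,
        Real.zero_rpow (by norm_num), ENNReal.ofReal_zero]
  have hAeq : A = ‖∫ t, h t * φ t‖ₑ := by
    have e : ∀ t, h t * φ t = ((S.indicator (fun t => ‖φ t‖ ^ 4) t : ℝ) : ℂ) := fun t => by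
      by_cases ht : t ∈ S
      · rw [hh, Set.indicator_of_mem ht, Set.indicator_of_mem ht, mul_right_comm,
          mul_comm _ (φ t), mul_conj, normSq_eq_norm_sq]
        push_cast
        ring
      · rw [hh, Set.indicator_of_notMem ht, Set.indicator_of_notMem ht]
        simp
    simp_rw [e]
    rw [integral_complex_ofReal, integral_indicator hSm, ← ofReal_norm, Complex.norm_real,
      Real.norm_of_nonneg (integral_nonneg fun t => by positivity)]
    rw [ofReal_integral_eq_lintegral_ofReal, hA]
    · refine lintegral_congr fun t => ?_
      rw [ENNReal.ofReal_pow (norm_nonneg _), ofReal_norm]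
    · refine Measure.integrableOn_of_bounded (M := M ^ 4) (by simp [hS]) (by fun_prop)
        (ae_of_all _ fun t => ?_)
      rw [Real.norm_of_nonneg (by positivity)]
      gcongr
      exact hφM t
    · exact ae_of_all _ fun t => by positivity
  set H : ℝ → ℂ := fun ξ => ∫ t, h t * cexp ((2 * π * x t * ξ - t * √ξ : ℝ) * I) with hH
  have hHm : AEStronglyMeasurable H ν := by
    refine AEStronglyMeasurable.integral_prod_right' (f := fun q : ℝ × ℝ =>
      h q.2 * cexp ((2 * π * x q.2 * q.1 - q.2 * √q.1 : ℝ) * I)) ?_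
    refine Measurable.aestronglyMeasurable ?_
    fun_prop
  have hswap : ∫ t, h t * φ t = ∫ ξ, g ξ * H ξ ∂ν := by
    have hint : Integrable (Function.uncurry fun (t ξ : ℝ) =>
        cexp ((2 * π * x t * ξ - t * √ξ : ℝ) * I) * (h t * g ξ)) (volume.prod ν) := by
      refine (hhi.mul_prod hg).bdd_mul (c := 1) ?_
        (ae_of_all _ fun q => (norm_exp_ofReal_mul_I _).le)
      refine Measurable.aestronglyMeasurable ?_
      fun_prop
    calc ∫ t, h t * φ t = ∫ t, ∫ ξ, cexp ((2 * π * x t * ξ - t * √ξ : ℝ) * I) * (h t * g ξ) ∂ν := by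
          refine integral_congr_ae (ae_of_all _ fun t => ?_)
          simp only [hφ, posHalfWave]
          rw [← integral_const_mul]
          refine integral_congr_ae (ae_of_all _ fun ξ => ?_)
          simp only
          ring
      _ = ∫ ξ, (∫ t, cexp ((2 * π * x t * ξ - t * √ξ : ℝ) * I) * (h t * g ξ)) ∂ν :=
          integral_integral_swap hint
      _ = ∫ ξ, g ξ * H ξ ∂ν := by
          refine integral_congr_ae (ae_of_all _ fun ξ => ?_)
          simp only [hH]
          rw [← integral_const_mul]
          refine integral_congr_ae (ae_of_all _ fun t => ?_)
          simp only
          ring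
  have hHold : A ≤ (∫⁻ ξ, ‖g ξ‖ₑ ^ 2 ∂ν) ^ (1/2 : ℝ) * (∫⁻ ξ, ‖H ξ‖ₑ ^ 2 ∂ν) ^ (1/2 : ℝ) := by
    rw [hAeq, hswap]
    refine (enorm_integral_le_lintegral_enorm _).trans ?_
    have := ENNReal.lintegral_mul_le_Lp_mul_Lq ν Real.HolderConjugate.two_two
      hg.1.enorm hHm.enorm
    simpa [enorm_mul] using this
  have hdual := lintegral_enorm_integral_halfWave_dual_le hB hx hhm hhi
  rw [hA43] at hdual
  refine ENNReal.le_sq_of_le_rpow_mul hAfin ?_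
  calc A ≤ (∫⁻ ξ, ‖g ξ‖ₑ ^ 2 ∂ν) ^ (1/2 : ℝ) * (∫⁻ ξ, ‖H ξ‖ₑ ^ 2 ∂ν) ^ (1/2 : ℝ) := hHold
    _ ≤ (∫⁻ ξ, ‖g ξ‖ₑ ^ 2 ∂ν) ^ (1/2 : ℝ) *
        (ENNReal.ofReal (16 * B ^ (3/4 : ℝ)) * (30 * A ^ (3/2 : ℝ))) ^ (1/2 : ℝ) := by gcongr
    _ = _ := by
        rw [← ENNReal.mul_rpow_of_nonneg _ _ (by norm_num),
          ← ENNReal.mul_rpow_of_nonneg _ _ (by norm_num)]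
        congr 1
        ring

/-- The supremum over space of the positive-frequency half-wave evolution. -/
def posHalfWaveSup (B : ℝ) (g : ℝ → ℂ) (t : ℝ) : ℝ≥0∞ := ⨆ x : ℝ, ‖posHalfWave B g t x‖ₑ

lemma posHalfWaveSup_eq {B : ℝ} {g : ℝ → ℂ} (hg : IntegrableOn g (Set.Ioc 0 B)) (t : ℝ) :
    posHalfWaveSup B g t = ⨆ n : ℕ, ‖posHalfWave B g t (TopologicalSpace.denseSeq ℝ n)‖ₑ := by
  refine le_antisymm (iSup_le fun x => ?_)
    (iSup_le fun n => le_iSup (fun x => ‖posHalfWave B g t x‖ₑ) _)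
  refine (TopologicalSpace.denseRange_denseSeq ℝ).induction_on
    (p := fun x => ‖posHalfWave B g t x‖ₑ ≤ _) x ?_ fun n => le_iSup
      (fun n => ‖posHalfWave B g t (TopologicalSpace.denseSeq ℝ n)‖ₑ) n
  have := (continuous_posHalfWave hg).comp (by fun_prop : Continuous fun x : ℝ => (t, x))
  exact isClosed_le this.enorm continuous_const

lemma measurable_posHalfWaveSup {B : ℝ} {g : ℝ → ℂ} (hg : IntegrableOn g (Set.Ioc 0 B)) :
    Measurable (posHalfWaveSup B g) := by
  rw [funext (posHalfWaveSup_eq hg)]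
  refine Measurable.iSup fun n => ?_
  have := (continuous_posHalfWave hg).comp
    (by fun_prop : Continuous fun t : ℝ => (t, TopologicalSpace.denseSeq ℝ n))
  exact this.enorm.measurable

/-- Strichartz estimate for frequencies in `(0, B]`. -/
lemma lintegral_posHalfWaveSup_le {B : ℝ} (hB : 0 < B) {g : ℝ → ℂ}
    (hg : IntegrableOn g (Set.Ioc 0 B)) :
    ∫⁻ t, posHalfWaveSup B g t ^ 4 ≤
      (30 * ENNReal.ofReal (16 * B ^ (3/4 : ℝ)) * ∫⁻ ξ in Set.Ioc 0 B, ‖g ξ‖ₑ ^ 2) ^ 2 := by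
  set q : ℕ → ℝ := TopologicalSpace.denseSeq ℝ with hq
  have hc := continuous_posHalfWave hg
  let X : ℕ → ℝ → ℝ := fun n => Nat.rec (fun _ => q 0) (fun n f t =>
    if ‖posHalfWave B g t (f t)‖ₑ ≤ ‖posHalfWave B g t (q (n + 1))‖ₑ then q (n + 1) else f t) n
  have hX : ∀ n t, X (n + 1) t = if ‖posHalfWave B g t (X n t)‖ₑ ≤
      ‖posHalfWave B g t (q (n + 1))‖ₑ then q (n + 1) else X n t := fun n t => rfl
  have hwm : ∀ y : ℝ → ℝ, Measurable y → Measurable fun t => ‖posHalfWave B g t (y t)‖ₑ :=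
    fun y hy => (hc.measurable.comp (by fun_prop : Measurable fun t => (t, y t))).enorm
  have hXm : ∀ n, Measurable (X n) := by
    intro n
    induction n with
    | zero => exact measurable_const
    | succ n ih =>
      rw [funext (hX n)]
      exact Measurable.ite (measurableSet_le (hwm _ ih) (hwm _ measurable_const))
        measurable_const ih
  have hmono : ∀ t, Monotone fun n => ‖posHalfWave B g t (X n t)‖ₑ := fun t => by
    refine monotone_nat_of_le_succ fun n => ?_
    rw [hX]
    split_ifs with h
    · exact h
    · exact le_rfl
  have hXq : ∀ n t, ‖posHalfWave B g t (q n)‖ₑ ≤ ‖posHalfWave B g t (X n t)‖ₑ := by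
    intro n t
    cases n with
    | zero => exact le_rfl
    | succ n =>
      rw [hX]
      split_ifs with h
      · exact le_rfl
      · exact (not_le.1 h).le
  set Ψ : ℕ → ℝ → ℝ≥0∞ := fun n =>
    (Set.Icc (-(n:ℝ)) n).indicator fun t => ‖posHalfWave B g t (X n t)‖ₑ ^ 4 with hΨ
  have hΨm : ∀ n, Measurable (Ψ n) := fun n =>
    ((hwm _ (hXm n)).pow_const 4).indicator measurableSet_Icc
  have hΨmono : Monotone Ψ := by
    intro m n hmn t
    have hmn' : (m : ℝ) ≤ n := by exact_mod_cast hmn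
    by_cases ht : t ∈ Set.Icc (-(m:ℝ)) m
    · have ht' : t ∈ Set.Icc (-(n:ℝ)) n := ⟨by linarith [ht.1], by linarith [ht.2]⟩
      simp only [hΨ]
      rw [Set.indicator_of_mem ht, Set.indicator_of_mem ht']
      gcongr
      exact hmono t hmn
    · simp only [hΨ]
      rw [Set.indicator_of_notMem ht]
      exact zero_le
  calc ∫⁻ t, posHalfWaveSup B g t ^ 4 ≤ ∫⁻ t, ⨆ n, Ψ n t := by
        refine lintegral_mono fun t => ?_
        rw [posHalfWaveSup_eq hg, ENNReal.iSup_pow]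
        refine iSup_le fun n => ?_
        obtain ⟨m, hm⟩ := exists_nat_ge |t|
        refine le_trans ?_ (le_iSup (fun n => Ψ n t) (max m n))
        have hmt : |t| ≤ (max m n : ℕ) := hm.trans (by exact_mod_cast le_max_left m n)
        simp only [hΨ]
        rw [Set.indicator_of_mem (Set.mem_Icc.2 (abs_le.1 hmt))]
        gcongr
        exact (hXq n t).trans (hmono t (le_max_right m n))
    _ = ⨆ n, ∫⁻ t, Ψ n t := lintegral_iSup hΨm hΨmono
    _ ≤ _ := by
        refine iSup_le fun n => ?_
        rw [lintegral_indicator measurableSet_Icc]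
        exact setLIntegral_enorm_posHalfWave_curve_le hB hg (hXm n) n

/-- A measurable majorant for the spatial supremum of the half-wave evolution with Fourier
data `g` supported in `[-B, B]`. -/
def halfWaveMaj (B : ℝ) (g : ℝ → ℂ) (t : ℝ) : ℝ≥0∞ :=
  posHalfWaveSup B g t + posHalfWaveSup B (fun ξ => g (-ξ)) t

lemma measurable_halfWaveMaj {B : ℝ} {g : ℝ → ℂ} (hg : Integrable g) :
    Measurable (halfWaveMaj B g) :=
  (measurable_posHalfWaveSup hg.integrableOn).add
    (measurable_posHalfWaveSup hg.comp_neg.integrableOn)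

lemma ENNReal.add_pow_four_le (a b : ℝ≥0∞) : (a + b) ^ 4 ≤ 16 * (a ^ 4 + b ^ 4) := by
  have h : ∀ c d : ℝ≥0∞, c ≤ d → (c + d) ^ 4 ≤ 16 * (c ^ 4 + d ^ 4) := fun c d hcd =>
    calc (c + d) ^ 4 ≤ (d + d) ^ 4 := by gcongr
      _ = 16 * d ^ 4 := by ring
      _ ≤ 16 * (c ^ 4 + d ^ 4) := by gcongr; exact le_add_self
  rcases le_total a b with hab | hab
  · exact h a b hab
  · rw [add_comm a, add_comm (a ^ 4)]
    exact h b a hab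

lemma lintegral_halfWaveMaj_le {B : ℝ} (hB : 0 < B) {g : ℝ → ℂ} (hg : Integrable g) :
    ∫⁻ t, halfWaveMaj B g t ^ 4 ≤
      32 * (30 * ENNReal.ofReal (16 * B ^ (3/4 : ℝ)) * ∫⁻ ξ, ‖g ξ‖ₑ ^ 2) ^ 2 := by
  have key : ∀ f : ℝ → ℂ, Integrable f → ∫⁻ t, posHalfWaveSup B f t ^ 4 ≤
      (30 * ENNReal.ofReal (16 * B ^ (3/4 : ℝ)) * ∫⁻ ξ, ‖f ξ‖ₑ ^ 2) ^ 2 := fun f hf => by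
    refine (lintegral_posHalfWaveSup_le hB hf.integrableOn).trans ?_
    gcongr
    exact Measure.restrict_le_self
  have h1 := key g hg
  have h2 := key _ hg.comp_neg
  rw [lintegral_neg_eq_self (μ := volume) (fun ξ => ‖g ξ‖ₑ ^ 2)] at h2
  calc ∫⁻ t, halfWaveMaj B g t ^ 4
      ≤ ∫⁻ t, 16 * (posHalfWaveSup B g t ^ 4 + posHalfWaveSup B (fun ξ => g (-ξ)) t ^ 4) :=
        lintegral_mono fun t => ENNReal.add_pow_four_le _ _
    _ = 16 * ((∫⁻ t, posHalfWaveSup B g t ^ 4) +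
          ∫⁻ t, posHalfWaveSup B (fun ξ => g (-ξ)) t ^ 4) := by
        rw [lintegral_const_mul' _ _ (by norm_num), lintegral_add_left
          ((measurable_posHalfWaveSup hg.integrableOn).pow_const 4)]
    _ ≤ 16 * ((30 * ENNReal.ofReal (16 * B ^ (3/4 : ℝ)) * ∫⁻ ξ, ‖g ξ‖ₑ ^ 2) ^ 2 +
          (30 * ENNReal.ofReal (16 * B ^ (3/4 : ℝ)) * ∫⁻ ξ, ‖g ξ‖ₑ ^ 2) ^ 2) := by gcongr
    _ = _ := by
        rw [← two_mul, ← mul_assoc]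
        norm_num

lemma fourierInv_halfWave_eq {B : ℝ} {g : ℝ → ℂ} (hg : Integrable g)
    (hB : ∀ ξ, B < |ξ| → g ξ = 0) (t x : ℝ) :
    𝓕⁻ (fun ξ => cexp (-(t * √|ξ|) * I) * g ξ) x =
      posHalfWave B g t x + posHalfWave B (fun ξ => g (-ξ)) t (-x) := by
  rw [Real.fourierInv_eq']
  set F : ℝ → ℂ := fun ξ => cexp ((2 * π * x * ξ - t * √|ξ| : ℝ) * I) * g ξ with hF
  have e : ∀ ξ : ℝ, cexp (↑(2 * π * inner ℝ ξ x) * I) • (cexp (-(t * √|ξ|) * I) * g ξ) = F ξ := by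
    intro ξ
    rw [smul_eq_mul, ← mul_assoc, ← Complex.exp_add, hF]
    simp only
    congr 2
    simp
    ring
  have hFi : Integrable F := hg.bdd_mul (c := 1)
    (by fun_prop : Continuous fun ξ : ℝ =>
      cexp ((2 * π * x * ξ - t * √|ξ| : ℝ) * I)).aestronglyMeasurable
    (ae_of_all _ fun ξ => (norm_exp_ofReal_mul_I _).le)
  have hpos : ∀ G : ℝ → ℂ, (∀ ξ, B < |ξ| → G ξ = 0) →
      ∫ ξ in Set.Ioi 0, G ξ = ∫ ξ in Set.Ioc 0 B, G ξ := fun G hG => by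
    refine setIntegral_eq_of_subset_of_forall_sdiff_eq_zero measurableSet_Ioi
      Set.Ioc_subset_Ioi_self fun ξ hξ => hG ξ ?_
    have h0 : 0 < ξ := hξ.1
    rw [abs_of_pos h0]
    by_contra h
    exact hξ.2 ⟨h0, not_lt.1 h⟩
  have hF0 : ∀ ξ, B < |ξ| → F ξ = 0 := fun ξ hξ => by
    simp only [hF]
    rw [hB ξ hξ, mul_zero]
  simp_rw [e]
  rw [← intervalIntegral.integral_Iic_add_Ioi (b := 0) hFi.integrableOn hFi.integrableOn,
    add_comm, hpos F hF0]
  have hneg := integral_comp_neg_Ioi 0 F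
  rw [neg_zero] at hneg
  rw [← hneg, hpos _ fun ξ hξ => hF0 _ (by rwa [abs_neg])]
  congr 1
  · refine setIntegral_congr_fun measurableSet_Ioc fun ξ hξ => ?_
    simp only [hF]
    rw [abs_of_pos hξ.1]
  · refine setIntegral_congr_fun measurableSet_Ioc fun ξ hξ => ?_
    simp only [hF]
    rw [abs_neg, abs_of_pos hξ.1]
    congr 4
    ring

lemma fourier_fourierInv_eq_self_or_zero {F : ℝ → ℂ} (hF : Continuous F) :
    𝓕 (𝓕⁻ F) = F ∨ 𝓕 (𝓕⁻ F) = 0 := by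
  have hundef : ∀ G : ℝ → ℂ, ¬ Integrable G → 𝓕 G = 0 := fun G hG => by
    ext w
    rw [Real.fourier_eq]
    exact integral_undef fun h => hG ((Real.fourierIntegral_convergent_iff w).1 h)
  by_cases h1 : Integrable F
  · by_cases h2 : Integrable (𝓕⁻ F)
    · left
      refine hF.fourier_fourierInv_eq h1 ?_
      have := h2.comp_neg
      simpa only [Real.fourierInv_eq_fourier_neg, neg_neg] using this
    · exact Or.inr (hundef _ h2)
  · right
    have : 𝓕⁻ F = 0 := by
      ext w
      rw [Real.fourierInv_eq_fourier_neg, hundef F h1]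
      rfl
    rw [this]
    ext w
    simp [Real.fourier_eq]

lemma continuous_fourier (u : ℝ → ℂ) : Continuous (𝓕 u) := by
  by_cases h : Integrable u
  · exact VectorFourier.fourierIntegral_continuous Real.continuous_fourierChar
      (continuous_inner (𝕜 := ℝ) (E := ℝ)) h
  · have : 𝓕 u = 0 := by
      ext w
      rw [Real.fourier_eq]
      exact integral_undef fun h' => h ((Real.fourierIntegral_convergent_iff w).1 h')
    rw [this]
    exact continuous_zero

/-- A frequency-localized multiplier applied to the half-wave evolution is dominated, uniformly
in space, by the majorant of its Fourier data. -/
lemma LooNorm_multiplier_halfWave_le {B : ℝ} {f m g : ℝ → ℂ} (hf : Continuous f)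
    (hg : Integrable g) (hmg : (fun ξ => m ξ * f ξ) =ᵐ[volume] g)
    (hB : ∀ ξ, B < |ξ| → g ξ = 0) (t : ℝ) :
    LooNorm (𝓕⁻ (fun ξ => m ξ * 𝓕 (𝓕⁻ (fun ξ => cexp (-(t * √|ξ|) * I) * f ξ)) ξ)) ≤
      halfWaveMaj B g t := by
  refine iSup_le fun x => ?_
  rw [← enorm_eq_nnnorm]
  rcases fourier_fourierInv_eq_self_or_zero
    (by fun_prop : Continuous fun ξ : ℝ => cexp (-(t * √|ξ|) * I) * f ξ) with h | h
  · rw [h]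
    have : 𝓕⁻ (fun ξ => m ξ * (cexp (-(t * √|ξ|) * I) * f ξ)) x =
        𝓕⁻ (fun ξ => cexp (-(t * √|ξ|) * I) * g ξ) x := by
      rw [Real.fourierInv_eq_fourier_neg, Real.fourierInv_eq_fourier_neg]
      refine Real.fourier_congr_ae ?_ _
      filter_upwards [hmg] with ξ hξ
      rw [← hξ]
      ring
    rw [this, fourierInv_halfWave_eq hg hB]
    refine (enorm_add_le _ _).trans (add_le_add ?_ ?_)
    · exact le_iSup (fun x => ‖posHalfWave B g t x‖ₑ) x
    · exact le_iSup (fun x => ‖posHalfWave B (fun ξ => g (-ξ)) t x‖ₑ) (-x)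
  · rw [h, Real.fourierInv_eq]
    simp

lemma min_mul_rpow_le_rpow {Q y σ : ℝ} (hQ : 0 < Q) (h1 : Q ≤ y) (h2 : y ≤ 32 * Q) :
    min 1 ((32:ℝ) ^ σ) * Q ^ σ ≤ y ^ σ := by
  have hz1 : 1 ≤ y / Q := (one_le_div hQ).2 h1
  have hz2 : y / Q ≤ 32 := (div_le_iff₀ hQ).2 h2
  have hy : y = y / Q * Q := by field_simp
  rw [hy, Real.mul_rpow (by positivity) hQ.le]
  gcongr
  rcases le_total 0 σ with hσ | hσ
  · exact (min_le_left _ _).trans (Real.one_le_rpow hz1 hσ)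
  · exact (min_le_right _ _).trans (Real.rpow_le_rpow_of_nonpos (by linarith) hz2 hσ)

lemma integrable_indicator_mul_of_subset_Icc {B : ℝ} {A : Set ℝ} (hA : MeasurableSet A)
    (hAB : A ⊆ Set.Icc (-B) B) {p f : ℝ → ℂ} (hp : Continuous p) (hf : Continuous f) :
    Integrable (A.indicator fun ξ => p ξ * f ξ) :=
  (integrable_indicator_iff hA).2 ((hp.mul hf).integrableOn_Icc.mono_set hAB)

/-- Weighted Strichartz estimate for Fourier data localized where `1 + ξ ^ 2` is comparable
to `Q`. -/
lemma lintegral_halfWaveMaj_indicator_le {σ N B Q : ℝ} (hB : 0 < B) (hQ : 0 < Q)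
    {A : Set ℝ} (hA : MeasurableSet A) (hAB : A ⊆ Set.Icc (-B) B)
    (hAQ : ∀ ξ ∈ A, Q ≤ 1 + ξ ^ 2 ∧ 1 + ξ ^ 2 ≤ 32 * Q) {p f : ℝ → ℂ} (hp : Continuous p)
    (hpN : ∀ ξ, ‖p ξ‖ ≤ N) (hf : Continuous f) :
    ∫⁻ t, halfWaveMaj B (A.indicator fun ξ => p ξ * f ξ) t ^ 4 ≤
      ENNReal.ofReal (32 * (480 * N ^ 2 / min 1 ((32:ℝ) ^ σ)) ^ 2 *
        (B ^ (3/2 : ℝ) * Q ^ (-2 * σ))) *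
        (∫⁻ ξ in A, ENNReal.ofReal ((1 + ξ ^ 2) ^ σ) * ‖f ξ‖ₑ ^ 2) ^ 2 := by
  set κ := min 1 ((32:ℝ) ^ σ) with hκ
  have hκ0 : 0 < κ := lt_min one_pos (by positivity)
  have hQσ : 0 < Q ^ σ := by positivity
  have h1 : ∫⁻ ξ, ‖A.indicator (fun ξ => p ξ * f ξ) ξ‖ₑ ^ 2 ≤
      ENNReal.ofReal (N ^ 2 / (κ * Q ^ σ)) *
        ∫⁻ ξ in A, ENNReal.ofReal ((1 + ξ ^ 2) ^ σ) * ‖f ξ‖ₑ ^ 2 := by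
    rw [← lintegral_const_mul' _ _ ENNReal.ofReal_ne_top, ← lintegral_indicator hA]
    refine lintegral_mono fun ξ => ?_
    by_cases hξ : ξ ∈ A
    · rw [Set.indicator_of_mem hξ, Set.indicator_of_mem hξ, enorm_mul, mul_pow, ← mul_assoc,
        ← ENNReal.ofReal_mul (by positivity)]
      gcongr
      rw [← ofReal_norm, ← ENNReal.ofReal_pow (norm_nonneg _)]
      refine ENNReal.ofReal_le_ofReal ?_
      have hw := min_mul_rpow_le_rpow (σ := σ) hQ (hAQ ξ hξ).1 (hAQ ξ hξ).2
      calc ‖p ξ‖ ^ 2 ≤ N ^ 2 := by gcongr; exact hpN ξ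
        _ = N ^ 2 / (κ * Q ^ σ) * (κ * Q ^ σ) := by field_simp
        _ ≤ _ := by gcongr
    · rw [Set.indicator_of_notMem hξ]
      simp
  refine (lintegral_halfWaveMaj_le hB
    (integrable_indicator_mul_of_subset_Icc hA hAB hp hf)).trans ?_
  calc 32 * (30 * ENNReal.ofReal (16 * B ^ (3/4 : ℝ)) *
        ∫⁻ ξ, ‖A.indicator (fun ξ => p ξ * f ξ) ξ‖ₑ ^ 2) ^ 2
      ≤ 32 * (30 * ENNReal.ofReal (16 * B ^ (3/4 : ℝ)) * (ENNReal.ofReal (N ^ 2 / (κ * Q ^ σ)) *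
        ∫⁻ ξ in A, ENNReal.ofReal ((1 + ξ ^ 2) ^ σ) * ‖f ξ‖ₑ ^ 2)) ^ 2 := by gcongr
    _ = 32 * (30 * ENNReal.ofReal (16 * B ^ (3/4 : ℝ)) * ENNReal.ofReal (N ^ 2 / (κ * Q ^ σ))) ^ 2
        * (∫⁻ ξ in A, ENNReal.ofReal ((1 + ξ ^ 2) ^ σ) * ‖f ξ‖ₑ ^ 2) ^ 2 := by
        rw [mul_assoc 32, ← mul_pow, mul_assoc (30 * _)]
    _ = _ := by
        congr 1
        rw [show (32 : ℝ≥0∞) = ENNReal.ofReal 32 by norm_num,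
          show (30 : ℝ≥0∞) = ENNReal.ofReal 30 by norm_num, ← ENNReal.ofReal_mul (by positivity),
          ← ENNReal.ofReal_mul (by positivity), ← ENNReal.ofReal_pow (by positivity),
          ← ENNReal.ofReal_mul (by positivity)]
        congr 1
        have e1 : B ^ (3/2 : ℝ) = (B ^ (3/4 : ℝ)) ^ 2 := by
          rw [← Real.rpow_natCast, ← Real.rpow_mul hB.le]
          norm_num
        have e2 : Q ^ (-2 * σ) = ((Q ^ σ) ^ 2)⁻¹ := by
          rw [← Real.rpow_natCast, ← Real.rpow_mul hQ.le, ← Real.rpow_neg hQ.le]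
          congr 1
          push_cast
          ring
        rw [e1, e2]
        field_simp
        ring

lemma tsum_measure_dyadic_le (μ : Measure ℝ) :
    ∑' k : ℕ, μ {ξ : ℝ | 2 ^ k ≤ |ξ| ∧ |ξ| < 2 ^ (k + 1)} ≤ μ Set.univ := by
  rw [← measure_iUnion]
  · exact measure_mono (Set.subset_univ _)
  · have h : ∀ i j : ℕ, i < j → Disjoint {ξ : ℝ | 2 ^ i ≤ |ξ| ∧ |ξ| < 2 ^ (i + 1)}
        {ξ : ℝ | 2 ^ j ≤ |ξ| ∧ |ξ| < 2 ^ (j + 1)} := fun i j hij => by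
      rw [Set.disjoint_left]
      rintro ξ ⟨-, h1⟩ ⟨h2, -⟩
      have : (2:ℝ) ^ (i + 1) ≤ 2 ^ j := pow_le_pow_right₀ (by norm_num) hij
      linarith
    intro i j hij
    rcases hij.lt_or_gt with hlt | hlt
    · exact h i j hlt
    · exact (h j i hlt).symm
  · intro k
    exact (measurableSet_le measurable_const measurable_norm).inter
      (measurableSet_lt measurable_norm measurable_const)

lemma tsum_measure_annulus_sq_le (μ : Measure ℝ) :
    ∑' k : ℕ, μ {ξ : ℝ | 2 ^ k ≤ |ξ| ∧ |ξ| ≤ 2 ^ (k + 2)} ^ 2 ≤ 3 * μ Set.univ ^ 2 := by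
  set d : ℕ → ℝ≥0∞ := fun k => μ {ξ : ℝ | 2 ^ k ≤ |ξ| ∧ |ξ| < 2 ^ (k + 1)} with hd
  have hd1 : ∑' k, d k ≤ μ Set.univ := tsum_measure_dyadic_le μ
  have hshift : ∀ j, ∑' k, d (k + j) ≤ μ Set.univ := fun j =>
    (ENNReal.tsum_comp_le_tsum_of_injective (add_left_injective j) d).trans hd1
  have hk : ∀ k : ℕ, μ {ξ : ℝ | 2 ^ k ≤ |ξ| ∧ |ξ| ≤ 2 ^ (k + 2)} ≤
      d k + d (k + 1) + d (k + 2) := fun k => by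
    refine (measure_mono ?_).trans ((measure_union_le _ _).trans
      (add_le_add (measure_union_le _ _) le_rfl))
    rintro ξ ⟨h1, h2⟩
    by_cases h3 : |ξ| < 2 ^ (k + 1)
    · exact Or.inl (Or.inl ⟨h1, h3⟩)
    by_cases h4 : |ξ| < 2 ^ (k + 2)
    · exact Or.inl (Or.inr ⟨not_lt.1 h3, h4⟩)
    · refine Or.inr ⟨not_lt.1 h4, h2.trans_lt ?_⟩
      exact pow_lt_pow_right₀ (by norm_num) (by omega)
  calc ∑' k : ℕ, μ {ξ : ℝ | 2 ^ k ≤ |ξ| ∧ |ξ| ≤ 2 ^ (k + 2)} ^ 2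
      ≤ ∑' k : ℕ, μ Set.univ * (d k + d (k + 1) + d (k + 2)) := by
        refine ENNReal.tsum_le_tsum fun k => ?_
        rw [sq]
        exact mul_le_mul' (measure_mono (Set.subset_univ _)) (hk k)
    _ = μ Set.univ * ((∑' k, d k) + (∑' k, d (k + 1)) + ∑' k, d (k + 2)) := by
        rw [ENNReal.tsum_mul_left, ENNReal.tsum_add, ENNReal.tsum_add]
    _ ≤ μ Set.univ * (μ Set.univ + μ Set.univ + μ Set.univ) := by
        gcongr
        · exact hshift 1
        · exact hshift 2
    _ = _ := by ring

namespace LPFamily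

variable (χ : LPFamily)

lemma eq_zero_of_abs_lt {ξ : ℝ} (h : |ξ| < 1 / 2) : χ.χ ξ = 0 := by
  by_contra h0
  exact absurd (χ.supp ξ h0).1 (not_le.2 h)

lemma eq_zero_of_lt_abs {ξ : ℝ} (h : 2 < |ξ|) : χ.χ ξ = 0 := by
  by_contra h0
  exact absurd (χ.supp ξ h0).2 (not_le.2 h)

lemma exists_bound : ∃ M : ℝ, 0 ≤ M ∧ ∀ ξ, |χ.χ ξ| ≤ M := by
  obtain ⟨M, hM⟩ := (isCompact_Icc (a := (-2:ℝ)) (b := 2)).exists_bound_of_continuousOn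
    χ.smooth.continuous.continuousOn
  refine ⟨max M 0, le_max_right _ _, fun ξ => ?_⟩
  by_cases h : |ξ| ≤ 2
  · exact (hM ξ (abs_le.1 h)).trans (le_max_left _ _)
  · rw [χ.eq_zero_of_lt_abs (not_le.1 h), abs_zero]
    exact le_max_right _ _

lemma abs_div_two_pow (ξ : ℝ) (k : ℕ) : |ξ / 2 ^ k| = |ξ| / 2 ^ k := by
  rw [abs_div, abs_of_pos (by positivity : (0:ℝ) < 2 ^ k)]

lemma tsum_of_abs_lt {ξ : ℝ} (h : |ξ| < 2) : ∑' k : ℕ, χ.χ (ξ / 2 ^ (k + 1)) = χ.χ (ξ / 2) := by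
  rw [tsum_eq_single 0]
  · simp
  · intro k hk
    apply χ.eq_zero_of_abs_lt
    rw [abs_div_two_pow, div_lt_iff₀ (by positivity)]
    have : (2:ℝ) ^ 2 ≤ 2 ^ (k + 1) := pow_le_pow_right₀ (by norm_num) (by omega)
    linarith

lemma tsum_of_lt_abs {ξ : ℝ} (h : 2 < |ξ|) : ∑' k : ℕ, χ.χ (ξ / 2 ^ (k + 1)) = 1 := by
  have hξ : ξ ≠ 0 := by
    rintro rfl
    norm_num at h
  have hinj : Function.Injective fun k : ℕ => (k : ℤ) + 1 := fun a b hab => by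
    simpa using hab
  have := (hinj.hasSum_iff (f := fun k : ℤ => χ.χ (ξ / 2 ^ k)) (a := 1) ?_).2 (χ.hsum ξ hξ)
  · refine HasSum.tsum_eq ?_
    convert this using 2 with k
    change _ = χ.χ (ξ / 2 ^ ((k : ℤ) + 1))
    norm_cast
  · intro k hk
    have hk0 : k ≤ 0 := by
      by_contra hcon
      refine hk ⟨(k - 1).toNat, ?_⟩
      simp only
      omega
    apply χ.eq_zero_of_lt_abs
    have h2 : (0:ℝ) < 2 ^ k := by positivity
    rw [abs_div, abs_of_pos h2, lt_div_iff₀ h2]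
    have : (2:ℝ) ^ k ≤ 1 := zpow_le_one_of_nonpos₀ (by norm_num) hk0
    linarith

end LPFamily

lemma ENNReal.sup_iSup_pow_four_le (a : ℝ≥0∞) (b : ℕ → ℝ≥0∞) :
    (a ⊔ ⨆ k, b k) ^ 4 ≤ a ^ 4 + ∑' k, b k ^ 4 := by
  rcases le_total a (⨆ k, b k) with h | h
  · rw [sup_eq_right.2 h, ENNReal.iSup_pow]
    exact (iSup_le fun k => ENNReal.le_tsum k).trans le_add_self
  · rw [sup_eq_left.2 h]
    exact le_self_add

/-- The Fourier data of the low-frequency part. -/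
def lowData (χ : ℝ → ℝ) (f : ℝ → ℂ) : ℝ → ℂ :=
  (Set.Icc (-2:ℝ) 2).indicator fun ξ => ((1 - χ (ξ / 2) : ℝ) : ℂ) * f ξ

/-- The dyadic annulus containing the support of the `(k + 1)`-st Littlewood–Paley symbol. -/
def annulus (k : ℕ) : Set ℝ := {ξ : ℝ | 2 ^ k ≤ |ξ| ∧ |ξ| ≤ 2 ^ (k + 2)}

/-- The Fourier data of the `(k + 1)`-st Littlewood–Paley piece. -/
def highData (χ : ℝ → ℝ) (f : ℝ → ℂ) (k : ℕ) : ℝ → ℂ :=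
  (annulus k).indicator fun ξ => (χ (ξ / 2 ^ (k + 1)) : ℂ) * f ξ

lemma measurableSet_annulus (k : ℕ) : MeasurableSet (annulus k) :=
  (measurableSet_le measurable_const measurable_norm).inter
    (measurableSet_le measurable_norm measurable_const)

lemma annulus_subset_Icc (k : ℕ) : annulus k ⊆ Set.Icc (-2 ^ (k + 2)) (2 ^ (k + 2)) :=
  fun _ hξ => abs_le.1 hξ.2

lemma indicator_eq_zero_of_lt_abs {B : ℝ} {A : Set ℝ} (hA : A ⊆ Set.Icc (-B) B) (f : ℝ → ℂ)
    (ξ : ℝ) (hξ : B < |ξ|) : A.indicator f ξ = 0 :=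
  Set.indicator_of_notMem (fun h => absurd (abs_le.2 (hA h)) (not_le.2 hξ)) f

section

variable (χ : LPFamily) (u : ℝ → ℂ)

lemma integrable_lowData : Integrable (lowData χ.χ (𝓕 u)) := by
  have := χ.smooth.continuous
  exact integrable_indicator_mul_of_subset_Icc measurableSet_Icc subset_rfl (by fun_prop)
    (continuous_fourier u)

lemma integrable_highData (k : ℕ) : Integrable (highData χ.χ (𝓕 u) k) := by
  have := χ.smooth.continuous
  exact integrable_indicator_mul_of_subset_Icc (measurableSet_annulus k) (annulus_subset_Icc k)
    (by fun_prop) (continuous_fourier u)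

lemma LooNorm_LPlow_halfWave_le (t : ℝ) :
    LooNorm (LPlow χ.χ (halfWave t u)) ≤ halfWaveMaj 2 (lowData χ.χ (𝓕 u)) t := by
  refine LooNorm_multiplier_halfWave_le (continuous_fourier u) (integrable_lowData χ u) ?_
    (indicator_eq_zero_of_lt_abs subset_rfl _) t
  have hnull : ∀ᵐ ξ : ℝ, ξ ∉ ({2, -2} : Set ℝ) :=
    measure_eq_zero_iff_ae_notMem.1 ((Set.toFinite _).measure_zero _)
  filter_upwards [hnull] with ξ hξ
  have hne : |ξ| ≠ 2 := fun h => hξ (by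
    rcases (abs_eq (by norm_num)).1 h with h | h
    · exact Or.inl h
    · exact Or.inr h)
  rw [lowData]
  rcases hne.lt_or_gt with h | h
  · rw [χ.tsum_of_abs_lt h, Set.indicator_of_mem (Set.mem_Icc.2 (abs_le.1 h.le))]
  · rw [χ.tsum_of_lt_abs h, indicator_eq_zero_of_lt_abs subset_rfl _ _ h]
    simp

lemma LooNorm_LP_halfWave_le (k : ℕ) (t : ℝ) :
    LooNorm (LP χ.χ (k + 1) (halfWave t u)) ≤
      halfWaveMaj (2 ^ (k + 2)) (highData χ.χ (𝓕 u) k) t := by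
  refine LooNorm_multiplier_halfWave_le (continuous_fourier u) (integrable_highData χ u k) ?_
    (indicator_eq_zero_of_lt_abs (annulus_subset_Icc k) _) t
  refine ae_of_all _ fun ξ => ?_
  have e : (2:ℝ) ^ ((k : ℤ) + 1) = 2 ^ (k + 1) := by norm_cast
  simp only [e, highData]
  by_cases h : ξ ∈ annulus k
  · rw [Set.indicator_of_mem h]
  · rw [Set.indicator_of_notMem h]
    have : χ.χ (ξ / 2 ^ (k + 1)) = 0 := by
      by_contra h0
      refine h ?_
      have hs := χ.supp _ h0
      rw [LPFamily.abs_div_two_pow, Set.mem_Icc, le_div_iff₀ (by positivity),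
        div_le_iff₀ (by positivity)] at hs
      refine ⟨le_trans (le_of_eq ?_) hs.1, hs.2.trans (le_of_eq ?_)⟩ <;> ring
    rw [this]
    simp

/-- The squared `H^σ` norm as an integral against the weight. -/
lemma HNorm_sq_eq (σ : ℝ) :
    HNorm σ u ^ 2 = ∫⁻ ξ : ℝ, ENNReal.ofReal ((1 + ξ ^ 2) ^ σ) * ‖𝓕 u ξ‖ₑ ^ 2 := by
  rw [HNorm, ← ENNReal.rpow_natCast, ← ENNReal.rpow_mul]
  norm_num
  rfl

lemma lintegral_lowData_le {M σ : ℝ} (hM : ∀ ξ, |χ.χ ξ| ≤ M) :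
    ∫⁻ t, halfWaveMaj 2 (lowData χ.χ (𝓕 u)) t ^ 4 ≤
      ENNReal.ofReal (32 * (480 * (1 + M) ^ 2 / min 1 ((32:ℝ) ^ σ)) ^ 2 * 4) *
        (HNorm σ u ^ 2) ^ 2 := by
  have hc := χ.smooth.continuous
  have h := lintegral_halfWaveMaj_indicator_le (σ := σ) (N := 1 + M) (B := 2) (Q := 1)
    (A := Set.Icc (-2:ℝ) 2) (by norm_num) (by norm_num) measurableSet_Icc subset_rfl
    (fun ξ hξ => ?_) (p := fun ξ => ((1 - χ.χ (ξ / 2) : ℝ) : ℂ)) (f := 𝓕 u) (by fun_prop)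
    (fun ξ => ?_) (continuous_fourier u)
  · refine h.trans ?_
    rw [HNorm_sq_eq]
    refine mul_le_mul' (ENNReal.ofReal_le_ofReal ?_)
      (pow_le_pow_left' (setLIntegral_le_lintegral _ _) 2)
    have : (2:ℝ) ^ (3/2 : ℝ) ≤ 4 := by
      calc (2:ℝ) ^ (3/2 : ℝ) ≤ 2 ^ (2 : ℝ) :=
            Real.rpow_le_rpow_of_exponent_le (by norm_num) (by norm_num)
        _ = 4 := by norm_num
    rw [Real.one_rpow, mul_one]
    gcongr
  · exact ⟨by nlinarith, by nlinarith [hξ.1, hξ.2]⟩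
  · rw [Complex.norm_real, Real.norm_eq_abs]
    exact (abs_sub _ _).trans (by rw [abs_one]; gcongr; exact hM _)

lemma lintegral_highData_le {M s : ℝ} (hM : ∀ ξ, |χ.χ ξ| ≤ M) (k : ℕ) :
    ∫⁻ t, (ENNReal.ofReal ((2:ℝ) ^ (s * ((k:ℝ) + 1))) *
        halfWaveMaj (2 ^ (k + 2)) (highData χ.χ (𝓕 u) k) t) ^ 4 ≤
      ENNReal.ofReal (32 * (480 * (1 + M) ^ 2 / min 1 ((32:ℝ) ^ (s + 3/8))) ^ 2 *
        2 ^ (4 * s + 3)) *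
        (∫⁻ ξ in annulus k, ENNReal.ofReal ((1 + ξ ^ 2) ^ (s + 3/8)) * ‖𝓕 u ξ‖ₑ ^ 2) ^ 2 := by
  have hc := χ.smooth.continuous
  have h := lintegral_halfWaveMaj_indicator_le (σ := s + 3/8) (N := 1 + M) (B := 2 ^ (k + 2))
    (Q := 4 ^ k) (by positivity) (by positivity) (measurableSet_annulus k)
    (annulus_subset_Icc k) (fun ξ hξ => ?_) (p := fun ξ => (χ.χ (ξ / 2 ^ (k + 1)) : ℂ))
    (f := 𝓕 u) (by fun_prop) (fun ξ => ?_) (continuous_fourier u)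
  · simp_rw [mul_pow]
    rw [lintegral_const_mul' _ _ (by simp)]
    refine (mul_le_mul_right h _).trans (le_of_eq ?_)
    rw [← mul_assoc, ← ENNReal.ofReal_pow (by positivity), ← ENNReal.ofReal_mul (by positivity)]
    congr 2
    rw [mul_left_comm]
    congr 1
    have e4 : ((4:ℝ) ^ k) = 2 ^ (2 * (k:ℝ)) := by
      rw [Real.rpow_mul (by norm_num), Real.rpow_natCast]
      norm_num
    rw [e4, ← Real.rpow_natCast 2 (k + 2), ← Real.rpow_natCast _ 4,
      ← Real.rpow_mul (by norm_num), ← Real.rpow_mul (by norm_num),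
      ← Real.rpow_mul (by norm_num), ← Real.rpow_add (by norm_num),
      ← Real.rpow_add (by norm_num)]
    congr 1
    push_cast
    ring
  · have h4 : (4:ℝ) ^ k = (2 ^ k) ^ 2 := by
      rw [← pow_mul, mul_comm, pow_mul]
      norm_num
    have hpos : (1:ℝ) ≤ 2 ^ k := one_le_pow₀ (by norm_num)
    obtain ⟨h1, h2⟩ := hξ
    rw [pow_add] at h2
    rw [h4, ← sq_abs ξ]
    constructor
    · nlinarith
    · nlinarith [abs_nonneg ξ]
  · rw [Complex.norm_real, Real.norm_eq_abs]
    exact (hM _).trans (by linarith)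

lemma lintegral_BesovNorm_halfWave_pow_le {M s : ℝ} (hM : ∀ ξ, |χ.χ ξ| ≤ M) :
    ∫⁻ t : ℝ, BesovNorm χ.χ s (halfWave t u) ^ 4 ≤
      ENNReal.ofReal (32 * (480 * (1 + M) ^ 2 / min 1 ((32:ℝ) ^ (s + 3/8))) ^ 2 *
        (4 + 2 ^ (4 * s + 3) * 3)) * HNorm (s + 3/8) u ^ 4 := by
  set K := 32 * (480 * (1 + M) ^ 2 / min 1 ((32:ℝ) ^ (s + 3/8))) ^ 2 with hK
  have hK0 : 0 ≤ K := by positivity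
  set X := HNorm (s + 3/8) u ^ 2 with hX
  set w : ℝ → ℝ≥0∞ := fun ξ => ENNReal.ofReal ((1 + ξ ^ 2) ^ (s + 3/8)) * ‖𝓕 u ξ‖ₑ ^ 2 with hw
  have hmL := measurable_halfWaveMaj (B := 2) (integrable_lowData χ u)
  have hmH : ∀ k : ℕ, Measurable (halfWaveMaj (2 ^ (k + 2)) (highData χ.χ (𝓕 u) k)) :=
    fun k => measurable_halfWaveMaj (integrable_highData χ u k)
  have hsum : ∑' k : ℕ, (∫⁻ ξ in annulus k, w ξ) ^ 2 ≤ 3 * X ^ 2 := by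
    have := tsum_measure_annulus_sq_le (volume.withDensity w)
    rw [withDensity_apply _ MeasurableSet.univ, Measure.restrict_univ, ← HNorm_sq_eq] at this
    refine le_trans (le_of_eq ?_) this
    refine tsum_congr fun k => ?_
    rw [← withDensity_apply _ (measurableSet_annulus k)]
    rfl
  calc ∫⁻ t : ℝ, BesovNorm χ.χ s (halfWave t u) ^ 4
      ≤ ∫⁻ t, (halfWaveMaj 2 (lowData χ.χ (𝓕 u)) t ^ 4 +
          ∑' k : ℕ, (ENNReal.ofReal ((2:ℝ) ^ (s * ((k:ℝ) + 1))) *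
            halfWaveMaj (2 ^ (k + 2)) (highData χ.χ (𝓕 u) k) t) ^ 4) := by
        refine lintegral_mono fun t => le_trans ?_ (ENNReal.sup_iSup_pow_four_le _ _)
        refine pow_le_pow_left' (sup_le_sup (LooNorm_LPlow_halfWave_le χ u t)
          (iSup_mono fun k => ?_)) 4
        gcongr
        exact LooNorm_LP_halfWave_le χ u k t
    _ = (∫⁻ t, halfWaveMaj 2 (lowData χ.χ (𝓕 u)) t ^ 4) +
          ∑' k : ℕ, ∫⁻ t, (ENNReal.ofReal ((2:ℝ) ^ (s * ((k:ℝ) + 1))) *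
            halfWaveMaj (2 ^ (k + 2)) (highData χ.χ (𝓕 u) k) t) ^ 4 := by
        rw [lintegral_add_left (hmL.pow_const 4), lintegral_tsum]
        exact fun k => (((hmH k).const_mul _).pow_const 4).aemeasurable
    _ ≤ ENNReal.ofReal (K * 4) * X ^ 2 + ∑' k : ℕ, ENNReal.ofReal (K * 2 ^ (4 * s + 3)) *
          (∫⁻ ξ in annulus k, w ξ) ^ 2 :=
        add_le_add (lintegral_lowData_le χ u hM)
          (ENNReal.tsum_le_tsum fun k => lintegral_highData_le χ u hM k)
    _ ≤ ENNReal.ofReal (K * 4) * X ^ 2 +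
          ENNReal.ofReal (K * 2 ^ (4 * s + 3)) * (3 * X ^ 2) := by
        rw [ENNReal.tsum_mul_left]
        gcongr
    _ = _ := by
        rw [show (3 : ℝ≥0∞) = ENNReal.ofReal 3 by norm_num, ← mul_assoc,
          ← ENNReal.ofReal_mul (by positivity), ← add_mul,
          ← ENNReal.ofReal_add (by positivity) (by positivity), hX, ← pow_mul]
        congr 2
        ring

end

/-- Strichartz estimate `‖e^{-itΛ}u‖_{L⁴_t C_*^s} ≲ ‖u‖_{H^{s+3/8}}`. -/
theorem strichartz_estimate (χ : LPFamily) (s : ℝ) :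
    ∃ C : ℝ, 0 < C ∧
      ∀ u : ℝ → ℂ, HNorm (s + 3/8) u < ⊤ →
        (∫⁻ t : ℝ, (BesovNorm χ.χ s (halfWave t u)) ^ 4) ^ (1/4 : ℝ)
          ≤ ENNReal.ofReal C * HNorm (s + 3/8) u := by
  obtain ⟨M, hM0, hM⟩ := χ.exists_bound
  have hκ : 0 < min 1 ((32:ℝ) ^ (s + 3/8)) := lt_min one_pos (by positivity)
  refine ⟨(32 * (480 * (1 + M) ^ 2 / min 1 ((32:ℝ) ^ (s + 3/8))) ^ 2 *
        (4 + 2 ^ (4 * s + 3) * 3)) ^ (1/4 : ℝ), by positivity, fun u _ => ?_⟩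
  refine (ENNReal.rpow_le_rpow (lintegral_BesovNorm_halfWave_pow_le χ u hM)
    (by norm_num)).trans (le_of_eq ?_)
  rw [ENNReal.mul_rpow_of_nonneg _ _ (by norm_num), ENNReal.ofReal_rpow_of_pos (by positivity),
    ← ENNReal.rpow_natCast, ← ENNReal.rpow_mul]
  norm_num

end
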